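/- arXiv:2403.19959 — 3 statements merged into one kernel-verified Lean document; each statement's English description precedes it below -/
import Mathlib

section
/- Let W be a standard Brownian motion on a probability space (Ω, 𝓕, P), let t > 0, let C : [0,t] → ℝ be integrable and let E : [0,t] → ℝ be continuously differentiable. Let X₀ be a random variable with law N(x₀, σ₀²) that is independent of the process W. Define X := X₀ + ∫₀ᵗ C(s) ds + ∫₀ᵗ E(s) dW_s, where the Wiener integral is defined pathwise by integration by parts as E(t)W_t − ∫₀ᵗ E′(s)W_s ds. Then, for almost every w with respect to the law of W_t, the conditional distribution of X given W_t = w is the Gaussian distribution N( x₀ + ∫₀ᵗ C(s) ds + (w/t)·∫₀ᵗ E(s) ds , V₁²(t) ), where V₁²(t) = σ₀² + ∫₀ᵗ E(s)² ds − (∫₀ᵗ E(s) ds)²/t. -/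
open MeasureTheory ProbabilityTheory Real

/-- A standard Brownian motion: a real-valued process with a.s. continuous paths,
`W 0 = 0` a.s., such that every finite collection `(W t₁, …, W tₙ)` (for nonnegative
times) is a centered Gaussian vector with `Cov (W s) (W r) = min s r`; this is
expressed through the one-dimensional laws of all linear combinations. -/
def IsStandardBrownianMotion {Ω : Type*} [MeasureSpace Ω] (W : ℝ → Ω → ℝ) : Prop :=
  (∀ s : ℝ, Measurable (W s)) ∧
  (∀ᵐ ω : Ω, Continuous fun s : ℝ => W s ω) ∧
  (∀ᵐ ω : Ω, W 0 ω = 0) ∧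
  ∀ (n : ℕ) (ts : Fin n → ℝ) (c : Fin n → ℝ), (∀ i, 0 ≤ ts i) →
    Measure.map (fun ω => ∑ i, c i * W (ts i) ω) (ℙ : Measure Ω) =
      gaussianReal 0 (∑ i, ∑ j, c i * c j * min (ts i) (ts j)).toNNReal


open Filter Topology Finset Set Interval

/-- Riemann–Stieltjes sums along the uniform partition, evaluated at right endpoints. -/
theorem tendsto_sum_rightEndpoint_mul_integral {t B : ℝ} (ht : 0 < t) {g φ : ℝ → ℝ}
    (hg : IntervalIntegrable g volume 0 t) (hφ : Measurable φ)
    (hB : ∀ s ∈ Icc 0 t, ‖φ s‖ ≤ B) (hr : ∀ s, ContinuousWithinAt φ (Ici s) s) :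
    Tendsto (fun n : ℕ => ∑ i ∈ range (n + 1),
        (∫ s in (t * i / (n + 1 : ℕ))..(t * (i + 1 : ℕ) / (n + 1 : ℕ)), g s) *
          φ (t * (i + 1 : ℕ) / (n + 1 : ℕ)))
      atTop (𝓝 (∫ s in (0 : ℝ)..t, g s * φ s)) := by
  let r : ℕ → ℝ → ℝ := fun n s => t * ⌈s * (n + 1 : ℕ) / t⌉₊ / (n + 1 : ℕ)
  have hpos : ∀ n : ℕ, (0 : ℝ) < (n + 1 : ℕ) := fun n => by positivity
  have hr_ge : ∀ n s, s ≤ r n s := fun n s => by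
    have h := Nat.le_ceil (s * (n + 1 : ℕ) / t)
    have hn := hpos n
    rw [div_le_iff₀ ht] at h
    rw [le_div_iff₀ hn]
    linarith
  have hr_lt : ∀ n s, 0 ≤ s → r n s < s + t / (n + 1 : ℕ) := fun n s hs => by
    have hn := hpos n
    have h := Nat.ceil_lt_add_one (a := s * (n + 1 : ℕ) / t) (by positivity)
    rw [div_lt_iff₀ hn, add_mul, div_mul_cancel₀ _ hn.ne']
    have h2 := mul_lt_mul_of_pos_left h ht
    have : t * (s * (n + 1 : ℕ) / t + 1) = s * (n + 1 : ℕ) + t := by field_simp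
    linarith
  have hr_le : ∀ n s, s ≤ t → r n s ≤ t := fun n s hs => by
    have hn := hpos n
    rw [div_le_iff₀ hn]
    gcongr
    refine Nat.ceil_le.2 ?_
    rw [div_le_iff₀ ht, mul_comm]
    gcongr
  have hr_meas : ∀ n, Measurable (r n) := fun n => by
    have : Measurable fun s : ℝ => ⌈s * (n + 1 : ℕ) / t⌉₊ := by fun_prop
    fun_prop
  have hlim : ∀ s, 0 ≤ s → Tendsto (fun n => φ (r n s)) atTop (𝓝 (φ s)) := fun s hs => by
    refine (hr s).tendsto.comp (tendsto_nhdsWithin_iff.2 ⟨?_, .of_forall fun n => hr_ge n s⟩)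
    refine tendsto_of_tendsto_of_tendsto_of_le_of_le tendsto_const_nhds ?_
      (fun n => hr_ge n s) (fun n => (hr_lt n s hs).le)
    simpa using (tendsto_const_nhds (x := s)).add
      ((tendsto_const_div_atTop_nhds_zero_nat t).comp (tendsto_add_atTop_nat 1))
  have hmem : ∀ s ∈ Ι 0 t, 0 ≤ s ∧ s ≤ t := fun s hs => by
    rw [uIoc_of_le ht.le] at hs
    exact ⟨hs.1.le, hs.2⟩
  have hint : ∀ n, IntervalIntegrable (fun s => g s * φ (r n s)) volume 0 t := fun n => by
    rw [intervalIntegrable_iff] at hg ⊢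
    refine hg.mul_bdd (c := B) (hφ.comp (hr_meas n)).aestronglyMeasurable ?_
    filter_upwards [ae_restrict_mem measurableSet_uIoc] with s hs
    obtain ⟨h0, h1⟩ := hmem s hs
    exact hB _ ⟨h0.trans (hr_ge n s), hr_le n s h1⟩
  have hsum : ∀ n : ℕ, ∑ i ∈ range (n + 1),
        (∫ s in (t * i / (n + 1 : ℕ))..(t * (i + 1 : ℕ) / (n + 1 : ℕ)), g s) *
          φ (t * (i + 1 : ℕ) / (n + 1 : ℕ)) = ∫ s in (0 : ℝ)..t, g s * φ (r n s) := fun n => by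
    have hn := hpos n
    have h := intervalIntegral.sum_integral_adjacent_intervals (μ := volume)
      (f := fun s => g s * φ (r n s)) (a := fun i : ℕ => t * i / (n + 1 : ℕ)) (n := n + 1) ?_
    · have e0 : t * (0 : ℕ) / (n + 1 : ℕ) = 0 := by simp
      have e1 : t * (n + 1 : ℕ) / (n + 1 : ℕ) = t := by field_simp
      rw [e0, e1] at h
      rw [← h]
      refine sum_congr rfl fun i _ => ?_
      rw [← intervalIntegral.integral_mul_const]
      refine intervalIntegral.integral_congr_ae (.of_forall fun s hs => ?_)
      rw [uIoc_of_le (by gcongr; simp)] at hs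
      have : ⌈s * (n + 1 : ℕ) / t⌉₊ = i + 1 := by
        rw [Nat.ceil_eq_iff (by simp)]
        have h1 := hs.1
        have h2 := hs.2
        rw [div_lt_iff₀ hn] at h1
        rw [le_div_iff₀ hn] at h2
        refine ⟨?_, ?_⟩
        · rw [lt_div_iff₀ ht, Nat.add_sub_cancel]; linarith
        · rw [div_le_iff₀ ht]; linarith
      simp only [r, this]
    · intro i hi
      refine (hint n).mono_set ?_
      rw [Set.uIcc_of_le ht.le, Set.uIcc_of_le (by gcongr; simp)]
      refine Icc_subset_Icc (by positivity) ?_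
      rw [div_le_iff₀ hn]
      gcongr
      omega
  simp_rw [hsum]
  refine intervalIntegral.tendsto_integral_filter_of_dominated_convergence (fun s => ‖g s‖ * B)
    (.of_forall fun n => ?_) (.of_forall fun n => .of_forall fun s hs => ?_)
    (hg.norm.mul_const B) (.of_forall fun s hs => ?_)
  · exact (intervalIntegrable_iff.1 (hint n)).aestronglyMeasurable
  · obtain ⟨h0, h1⟩ := hmem s hs
    rw [norm_mul]
    gcongr
    exact hB _ ⟨h0.trans (hr_ge n s), hr_le n s h1⟩
  · exact (hlim s (hmem s hs).1).const_mul _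

/-- The quadratic form of the kernel `min` as the squared `L²` norm of a step function. -/
theorem integral_sq_sum_indicator_Iic {ι : Type*} [Fintype ι] {t : ℝ} (c ts : ι → ℝ)
    (hts : ∀ i, ts i ∈ Icc 0 t) :
    ∫ u in (0 : ℝ)..t, (∑ i, c i * (Iic (ts i)).indicator 1 u) ^ 2 =
      ∑ i, ∑ j, c i * c j * min (ts i) (ts j) := by
  have key : ∀ i j, IntervalIntegrable (fun u => c i * c j *
      (Iic (min (ts i) (ts j))).indicator 1 u) volume 0 t ∧
      ∫ u in (0 : ℝ)..t, c i * c j * (Iic (min (ts i) (ts j))).indicator 1 u =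
        c i * c j * min (ts i) (ts j) := fun i j => by
    have hm : min (ts i) (ts j) ∈ Icc 0 t :=
      ⟨le_min (hts i).1 (hts j).1, (min_le_left _ _).trans (hts i).2⟩
    constructor
    · refine IntervalIntegrable.const_mul (intervalIntegrable_iff.2 ?_) _
      exact Integrable.indicator (intervalIntegrable_iff.1 (intervalIntegrable_const (c := (1 : ℝ))))
        measurableSet_Iic
    · rw [intervalIntegral.integral_const_mul]
      have := intervalIntegral.integral_indicator (f := fun _ : ℝ => (1 : ℝ)) (μ := volume) hm
      simp only [intervalIntegral.integral_const, sub_zero, smul_eq_mul, mul_one] at this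
      congr 1
  calc _ = ∫ u in (0 : ℝ)..t, ∑ i, ∑ j, c i * c j *
          (Iic (min (ts i) (ts j))).indicator 1 u := by
        refine intervalIntegral.integral_congr fun u _ => ?_
        simp only [sq, sum_mul_sum]
        refine sum_congr rfl fun i _ => sum_congr rfl fun j _ => ?_
        rw [← Iic_inter_Iic, inter_indicator_one]
        simp only [Pi.mul_apply]
        ring
    _ = _ := by
        have hrow : ∀ i, IntervalIntegrable (fun u => ∑ j, c i * c j *
            (Iic (min (ts i) (ts j))).indicator 1 u) volume 0 t := fun i => by
          simpa only [Finset.sum_fn] using! IntervalIntegrable.sum univ fun j _ => (key i j).1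
        rw [intervalIntegral.integral_finsetSum fun i _ => hrow i]
        refine sum_congr rfl fun i _ => ?_
        rw [intervalIntegral.integral_finsetSum fun j _ => (key i j).1]
        exact sum_congr rfl fun j _ => (key i j).2

/-- Gaussian laws with fixed mean and convergent variances pass to almost sure limits. -/
theorem map_eq_gaussianReal_of_tendsto {Ω : Type*} {mΩ : MeasurableSpace Ω} {P : Measure Ω}
    [IsProbabilityMeasure P] {Y : ℕ → Ω → ℝ} {Z : Ω → ℝ} {m : ℝ} {v : ℕ → NNReal} {v' : NNReal}
    (hY : ∀ n, AEMeasurable (Y n) P) (hlaw : ∀ n, P.map (Y n) = gaussianReal m (v n))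
    (hv : Tendsto v atTop (𝓝 v')) (hlim : ∀ᵐ ω ∂P, Tendsto (fun n => Y n ω) atTop (𝓝 (Z ω))) :
    AEMeasurable Z P ∧ P.map Z = gaussianReal m v' := by
  have hZ : AEMeasurable Z P := aemeasurable_of_tendsto_metrizable_ae atTop hY hlim
  refine ⟨hZ, ?_⟩
  have := Measure.isProbabilityMeasure_map hZ
  refine Measure.ext_of_charFun (funext fun ξ => ?_)
  have hcf : ∀ {X : Ω → ℝ}, AEMeasurable X P →
      charFun (P.map X) ξ = ∫ ω, Complex.exp (ξ * X ω * Complex.I) ∂P := fun hX => by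
    rw [charFun_apply_real, integral_map hX (by fun_prop)]
  have h1 : Tendsto (fun n => charFun (P.map (Y n)) ξ) atTop (𝓝 (charFun (P.map Z) ξ)) := by
    simp_rw [fun n => hcf (hY n), hcf hZ]
    refine tendsto_integral_of_dominated_convergence (fun _ => 1) (fun n => ?_)
      (integrable_const 1) (fun n => .of_forall fun ω => ?_) ?_
    · have := hY n
      fun_prop
    · rw [← Complex.ofReal_mul, Complex.norm_exp_ofReal_mul_I]
    · filter_upwards [hlim] with ω hω
      exact ((Continuous.tendsto (f := fun x : ℝ => Complex.exp (ξ * x * Complex.I))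
        (by fun_prop) _).comp hω)
  refine tendsto_nhds_unique h1 ?_
  simp_rw [hlaw, charFun_gaussianReal]
  exact (Continuous.tendsto
    (f := fun x : NNReal => Complex.exp (ξ * m * Complex.I - (x : ℝ) * ξ ^ 2 / 2))
    (by fun_prop) _).comp hv

/-- The pathwise Wiener integral of `E`, plus an independent Gaussian variable, is Gaussian, and the
integral contributes the variance `∫ E²` (Itô isometry). -/
theorem map_add_wienerIntegral_eq_gaussianReal
    {Ω : Type*} [MeasureSpace Ω] [IsProbabilityMeasure (ℙ : Measure Ω)]
    {W : ℝ → Ω → ℝ} (hW : IsStandardBrownianMotion W) {t : ℝ} (ht : 0 < t) {E g : ℝ → ℝ}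
    (hg : IntervalIntegrable g volume 0 t)
    (hEg : ∀ u ∈ Icc 0 t, ∫ s in u..t, g s = E t - E u)
    {X₀ : Ω → ℝ} (hX₀ : Measurable X₀) {m : ℝ} {v : NNReal}
    (hlaw : Measure.map X₀ (ℙ : Measure Ω) = gaussianReal m v)
    (hindep : Indep (MeasurableSpace.comap X₀ inferInstance)
      (⨆ s : ℝ, MeasurableSpace.comap (W s) inferInstance) (ℙ : Measure Ω)) :
    AEMeasurable (fun ω => X₀ ω + (E t * W t ω - ∫ s in (0 : ℝ)..t, g s * W s ω)) ∧
    Measure.map (fun ω => X₀ ω + (E t * W t ω - ∫ s in (0 : ℝ)..t, g s * W s ω))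
      (ℙ : Measure Ω) = gaussianReal m (v + (∫ s in (0 : ℝ)..t, E s ^ 2).toNNReal) := by
  obtain ⟨hWm, hWc, -, hWlaw⟩ := hW
  let τ : ℕ → ℕ → ℝ := fun n i => t * i / (n + 1 : ℕ)
  let Δ : ℕ → ℕ → ℝ := fun n i => ∫ s in τ n i..τ n (i + 1), g s
  let J : ℕ → Ω → ℝ := fun n ω =>
    E t * W t ω - ∑ i ∈ range (n + 1), Δ n i * W (τ n (i + 1)) ω
  let f : ℕ → ℝ → ℝ := fun n u =>
    E t - ∑ i ∈ range (n + 1), Δ n i * (Ici u).indicator 1 (τ n (i + 1))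
  have hτ0 : ∀ n i, 0 ≤ τ n i := fun n i => by positivity
  have hτt : ∀ n i, i ≤ n + 1 → τ n i ≤ t := fun n i hi => by
    rw [div_le_iff₀ (by positivity)]
    gcongr
  have hτmono : ∀ n i, τ n i ≤ τ n (i + 1) := fun n i => by
    simp only [τ]
    gcongr
    simp
  have hflip : ∀ a u : ℝ, (Ici u).indicator (1 : ℝ → ℝ) a = (Iic a).indicator 1 u :=
    fun a u => by simp only [indicator, Set.mem_Ici, Set.mem_Iic]; rfl
  have hJlaw : ∀ n, Measure.map (J n) (ℙ : Measure Ω) =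
      gaussianReal 0 (∫ u in (0 : ℝ)..t, f n u ^ 2).toNNReal := fun n => by
    let ts : Fin (n + 2) → ℝ := Fin.cons t fun i : Fin (n + 1) => τ n (i + 1)
    let c : Fin (n + 2) → ℝ := Fin.cons (E t) fun i : Fin (n + 1) => -Δ n i
    have hts : ∀ i, ts i ∈ Icc 0 t := by
      refine Fin.cases ⟨ht.le, le_rfl⟩ fun i => ?_
      exact ⟨hτ0 n _, hτt n _ (by omega)⟩
    have h := hWlaw (n + 2) ts c fun i => (hts i).1
    rw [← integral_sq_sum_indicator_Iic c ts hts] at h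
    convert h using 3 with ω
    · simp only [J, Fin.sum_univ_succ (n := n + 1), ts, c, Fin.cons_zero, Fin.cons_succ,
        neg_mul, sum_neg_distrib]
      rw [← Fin.sum_univ_eq_sum_range (fun i => Δ n i * W (τ n (i + 1)) ω), sub_eq_add_neg]
    · refine intervalIntegral.integral_congr fun u hu => ?_
      rw [Set.uIcc_of_le ht.le] at hu
      simp only [f, Fin.sum_univ_succ (n := n + 1), ts, c, Fin.cons_zero, Fin.cons_succ,
        neg_mul, sum_neg_distrib, hflip]
      rw [← Fin.sum_univ_eq_sum_range (fun i => Δ n i * (Iic (τ n (i + 1))).indicator 1 u),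
        sub_eq_add_neg, indicator_of_mem (show u ∈ Iic t from hu.2)]
      simp
  have hJmeas : ∀ n, Measurable[⨆ s : ℝ, MeasurableSpace.comap (W s) inferInstance] (J n) :=
    fun n => by
    have hWs : ∀ s, Measurable[⨆ s : ℝ, MeasurableSpace.comap (W s) inferInstance] (W s) :=
      fun s => measurable_iff_comap_le.2 (le_iSup (fun s => MeasurableSpace.comap (W s) _) s)
    exact ((hWs t).const_mul _).sub
      (Finset.measurable_fun_sum _ fun i _ => (hWs _).const_mul _)
  have hJm : ∀ n, Measurable (J n) := fun n =>
    (hJmeas n).mono (iSup_le fun s => (hWm s).comap_le) le_rfl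
  have hflim : ∀ u ∈ Icc 0 t, Tendsto (fun n => f n u) atTop (𝓝 (E u)) := fun u hu => by
    have h := tendsto_sum_rightEndpoint_mul_integral (φ := (Ici u).indicator 1) (B := 1) ht hg
      (measurable_one.indicator measurableSet_Ici)
      (fun s _ => (norm_indicator_le_norm_self _ _).trans (by simp)) fun s => by
        by_cases hs : u ≤ s
        · refine (continuousWithinAt_const (b := (1 : ℝ))).congr (fun y hy => ?_) ?_
          · exact indicator_of_mem (show y ∈ Ici u from hs.trans hy) _
          · exact indicator_of_mem (show s ∈ Ici u from hs) _
        · refine ContinuousAt.continuousWithinAt ?_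
          refine (continuousAt_const (y := (0 : ℝ))).congr ?_
          filter_upwards [Iio_mem_nhds (not_le.1 hs)] with y hy
          exact (indicator_of_notMem (show y ∉ Ici u from not_le.2 (mem_Iio.1 hy)) _).symm
    have hint : ∫ s in (0 : ℝ)..t, g s * (Ici u).indicator 1 s = E t - E u := by
      rw [← hEg u hu, intervalIntegral.integral_of_le hu.2, ← integral_Icc_eq_integral_Ioc,
        intervalIntegral.integral_of_le ht.le, ← integral_Icc_eq_integral_Ioc,
        show (fun s => g s * (Ici u).indicator 1 s) = (Ici u).indicator g by
          ext s; by_cases hs : s ∈ Ici u <;> simp [hs],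
        setIntegral_indicator measurableSet_Ici]
      congr 2
      ext s
      simp only [Set.mem_inter_iff, Set.mem_Icc, Set.mem_Ici]
      exact ⟨fun h => ⟨h.2, h.1.2⟩, fun h => ⟨⟨hu.1.trans h.1, h.2⟩, h.1⟩⟩
    rw [hint] at h
    simpa [f, τ, Δ] using h.const_sub (E t)
  have hfbound : ∀ n u, ‖f n u‖ ≤ ‖E t‖ + ∫ s in (0 : ℝ)..t, ‖g s‖ := fun n u => by
    refine (norm_sub_le _ _).trans ?_
    gcongr
    have hτint : ∀ i < n + 1, IntervalIntegrable (fun s => ‖g s‖) volume (τ n i) (τ n (i + 1)) :=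
      fun i hi => by
        refine hg.norm.mono_set ?_
        rw [Set.uIcc_of_le ht.le, Set.uIcc_of_le (hτmono n i)]
        exact Icc_subset_Icc (hτ0 n i) (hτt n _ (by omega))
    have h0 : τ n 0 = 0 := by simp [τ]
    have h1 : τ n (n + 1) = t := by simp only [τ]; field_simp
    have hs := intervalIntegral.sum_integral_adjacent_intervals hτint
    rw [h0, h1] at hs
    rw [← hs]
    refine (norm_sum_le _ _).trans (sum_le_sum fun i _ => ?_)
    rw [norm_mul]
    refine (mul_le_of_le_one_right (norm_nonneg _)
      ((norm_indicator_le_norm_self _ _).trans (by simp))).trans ?_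
    exact intervalIntegral.norm_integral_le_integral_norm (hτmono n i)
  have hvlim : Tendsto (fun n => ∫ u in (0 : ℝ)..t, f n u ^ 2) atTop
      (𝓝 (∫ u in (0 : ℝ)..t, E u ^ 2)) := by
    refine intervalIntegral.tendsto_integral_filter_of_dominated_convergence
      (fun _ => (‖E t‖ + ∫ s in (0 : ℝ)..t, ‖g s‖) ^ 2) (.of_forall fun n => ?_)
      (.of_forall fun n => .of_forall fun u _ => ?_) intervalIntegrable_const
      (.of_forall fun u hu => ?_)
    · have : Measurable (f n) := by
        simp only [f, hflip]
        refine measurable_const.sub (Finset.measurable_fun_sum _ fun i _ => ?_)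
        exact (measurable_one.indicator measurableSet_Iic).const_mul _
      exact (this.pow_const 2).aestronglyMeasurable
    · rw [norm_pow]
      gcongr
      exact hfbound n u
    · rw [uIoc_of_le ht.le] at hu
      exact (hflim u ⟨hu.1.le, hu.2⟩).pow 2
  have hJlim : ∀ᵐ ω : Ω, Tendsto (fun n => J n ω) atTop
      (𝓝 (E t * W t ω - ∫ s in (0 : ℝ)..t, g s * W s ω)) := by
    filter_upwards [hWc] with ω hω
    obtain ⟨B, hB⟩ := isCompact_Icc.exists_bound_of_continuousOn
      (hω.continuousOn (s := Icc 0 t))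
    exact (tendsto_sum_rightEndpoint_mul_integral ht hg hω.measurable hB
      fun s => hω.continuousWithinAt).const_sub _
  refine map_eq_gaussianReal_of_tendsto (Y := fun n => X₀ + J n)
    (v := fun n => v + (∫ u in (0 : ℝ)..t, f n u ^ 2).toNNReal)
    (fun n => (hX₀.add (hJm n)).aemeasurable) (fun n => ?_) ?_ ?_
  · have hXJ : IndepFun X₀ (J n) (ℙ : Measure Ω) :=
      (IndepFun_iff_Indep _ _ _).2 (indep_of_indep_of_le_right hindep (hJmeas n).comap_le)
    rw [gaussianReal_add_gaussianReal_of_indepFun hXJ hlaw (hJlaw n), add_zero]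
  · exact ((continuous_real_toNNReal.tendsto _).comp hvlim).const_add v
  · filter_upwards [hJlim] with ω hω
    exact hω.const_add (X₀ ω)

/-- Two variables whose linear combinations are all Gaussian without cross term are independent. -/
theorem indepFun_of_forall_map_eq_gaussianReal {Ω : Type*} {mΩ : MeasurableSpace Ω}
    {P : Measure Ω} [IsProbabilityMeasure P] {Y R : Ω → ℝ} (hY : AEMeasurable Y P)
    (hR : AEMeasurable R P) {m : ℝ} {u v : NNReal}
    (h : ∀ p q : ℝ, P.map (fun ω => q * R ω + p * Y ω) =
      gaussianReal (q * m) (‖q‖₊ ^ 2 * v + ‖p‖₊ ^ 2 * u)) :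
    IndepFun Y R P := by
  have hcf : ∀ p q : ℝ, ∫ ω, Complex.exp ((q * R ω + p * Y ω : ℝ) * Complex.I) ∂P =
      Complex.exp (q * m * Complex.I - (q ^ 2 * v + p ^ 2 * u) / 2) := fun p q => by
    have hm : AEMeasurable (fun ω => q * R ω + p * Y ω) P := by fun_prop
    have h1 := congrArg (fun μ => charFun μ 1) (h p q)
    rw [charFun_gaussianReal, charFun_apply_real, integral_map hm (by fun_prop)] at h1
    simpa using h1
  rw [indepFun_iff_charFun_prod hY hR]
  intro ξ
  have e1 : charFun (P.map fun ω => WithLp.toLp 2 (Y ω, R ω)) ξ =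
      ∫ ω, Complex.exp ((ξ.snd * R ω + ξ.fst * Y ω : ℝ) * Complex.I) ∂P := by
    rw [charFun_apply, integral_map (by fun_prop) (by fun_prop)]
    simp only [WithLp.prod_inner_apply]
    refine integral_congr_ae (.of_forall fun ω => ?_)
    simp [add_comm]
  have e2 : ∀ {Z : Ω → ℝ} (z : ℝ), AEMeasurable Z P → charFun (P.map Z) z =
      ∫ ω, Complex.exp (z * Z ω * Complex.I) ∂P := fun z hZ => by
    rw [charFun_apply_real, integral_map hZ (by fun_prop)]
  have hYcf := hcf ξ.fst 0
  have hRcf := hcf 0 ξ.snd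
  simp only [zero_mul, zero_add, add_zero, Complex.ofReal_mul] at hYcf hRcf
  rw [e1, hcf, e2 _ hY, e2 _ hR, WithLp.ofLp_fst, WithLp.ofLp_snd, hYcf, hRcf, ← Complex.exp_add]
  congr 1
  simp
  ring

/-- Conditional law of `R + b * Y` given `Y`, for a Gaussian variable `R` independent of `Y`. -/
theorem condDistrib_add_mul_ae_eq_gaussianReal {Ω : Type*} {mΩ : MeasurableSpace Ω}
    {P : Measure Ω} [IsProbabilityMeasure P] {Y R : Ω → ℝ} (hY : AEMeasurable Y P)
    (hR : AEMeasurable R P) (hind : IndepFun Y R P) {m : ℝ} {v : NNReal}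
    (hlaw : P.map R = gaussianReal m v) (b : ℝ) :
    ∀ᵐ w ∂(P.map Y), condDistrib (fun ω => R ω + b * Y ω) Y P w = gaussianReal (m + b * w) v := by
  let κ : Kernel ℝ ℝ := ⟨fun w => gaussianReal (m + b * w) v,
    measurable_gaussianReal.comp (by fun_prop : Measurable fun w : ℝ => (m + b * w, v))⟩
  have : IsMarkovKernel κ := ⟨fun w => inferInstanceAs
    (IsProbabilityMeasure (gaussianReal (m + b * w) v))⟩
  have := Measure.isProbabilityMeasure_map hY
  have := Measure.isProbabilityMeasure_map hR
  refine condDistrib_ae_eq_of_measure_eq_compProd (κ := κ) Y (by fun_prop) ?_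
  have hF : Measurable fun z : ℝ × ℝ => (z.1, z.2 + b * z.1) := by fun_prop
  have e : P.map (fun ω => (Y ω, R ω + b * Y ω)) =
      ((P.map Y).prod (P.map R)).map fun z : ℝ × ℝ => (z.1, z.2 + b * z.1) := by
    rw [← (indepFun_iff_map_prod_eq_prod_map_map hY hR).1 hind,
      AEMeasurable.map_map_of_aemeasurable hF.aemeasurable (by fun_prop)]
    rfl
  rw [e]
  ext s hs
  rw [Measure.map_apply hF hs, Measure.prod_apply (hF hs), Measure.compProd_apply hs]
  refine lintegral_congr fun w => ?_
  have hκ : κ w = (P.map R).map (· + b * w) := by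
    rw [hlaw, gaussianReal_map_add_const]
    rfl
  rw [hκ, Measure.map_apply (by fun_prop) (measurable_prodMk_left hs)]
  rfl

theorem stochastic_integral_conditional_law_given_Wt
    {Ω : Type*} [MeasureSpace Ω] [IsProbabilityMeasure (ℙ : Measure Ω)]
    (W : ℝ → Ω → ℝ) (hW : IsStandardBrownianMotion W)
    (t : ℝ) (ht : 0 < t) (C E : ℝ → ℝ)
    (hC : IntervalIntegrable C volume 0 t)
    (hE : ContDiffOn ℝ 1 E (Set.Icc 0 t))
    (x₀ σ₀ : ℝ) (X₀ : Ω → ℝ) (hX₀meas : Measurable X₀)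
    (hX₀law : Measure.map X₀ (ℙ : Measure Ω) = gaussianReal x₀ ((σ₀ ^ 2).toNNReal))
    (hindep : Indep (MeasurableSpace.comap X₀ inferInstance)
      (⨆ s : ℝ, MeasurableSpace.comap (W s) inferInstance) (ℙ : Measure Ω))
    (X : Ω → ℝ)
    (hX : X = fun ω => X₀ ω + (∫ s in (0:ℝ)..t, C s) +
      (E t * W t ω - ∫ s in (0:ℝ)..t, derivWithin E (Set.Icc 0 t) s * W s ω)) :
    ∀ᵐ w ∂(Measure.map (W t) (ℙ : Measure Ω)),
      condDistrib X (W t) (ℙ : Measure Ω) w =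
        gaussianReal (x₀ + (∫ s in (0:ℝ)..t, C s) + (w / t) * ∫ s in (0:ℝ)..t, E s)
          ((σ₀ ^ 2 + (∫ s in (0:ℝ)..t, (E s) ^ 2) -
            (∫ s in (0:ℝ)..t, E s) ^ 2 / t).toNNReal) := by
  set c := ∫ s in (0 : ℝ)..t, C s
  set m := ∫ s in (0 : ℝ)..t, E s
  set S := ∫ s in (0 : ℝ)..t, E s ^ 2
  set g := derivWithin E (Set.Icc 0 t)
  have hEc : ContinuousOn E (uIcc 0 t) := by
    rw [Set.uIcc_of_le ht.le]
    exact hE.continuousOn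
  have hgc : ContinuousOn g (Icc 0 t) :=
    hE.continuousOn_derivWithin (uniqueDiffOn_Icc ht) le_rfl
  have hg : IntervalIntegrable g volume 0 t := by
    refine ContinuousOn.intervalIntegrable ?_
    rwa [Set.uIcc_of_le ht.le]
  have hEg : ∀ u ∈ Icc 0 t, ∫ s in u..t, g s = E t - E u := fun u hu => by
    refine intervalIntegral.integral_eq_sub_of_hasDerivAt_of_le hu.2
      (hE.continuousOn.mono (Icc_subset_Icc_left hu.1)) (fun s hs => ?_)
      (hg.mono_set ?_)
    · have hs' : s ∈ Icc 0 t := ⟨hu.1.trans hs.1.le, hs.2.le⟩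
      exact ((hE.differentiableOn one_ne_zero s hs').hasDerivWithinAt).hasDerivAt
        (Icc_mem_nhds (hu.1.trans_lt hs.1) hs.2)
    · rw [Set.uIcc_of_le ht.le, Set.uIcc_of_le hu.2]
      exact Icc_subset_Icc_left hu.1
  have hquad : ∀ a q : ℝ, ∫ s in (0 : ℝ)..t, (a + q * E s) ^ 2 =
      a ^ 2 * t + 2 * a * q * m + q ^ 2 * S := fun a q => by
    have h1 : IntervalIntegrable E volume 0 t := hEc.intervalIntegrable
    have h2 : IntervalIntegrable (fun s => E s ^ 2) volume 0 t := (hEc.pow 2).intervalIntegrable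
    have : ∀ s, (a + q * E s) ^ 2 = a ^ 2 + 2 * a * q * E s + q ^ 2 * E s ^ 2 := fun s => by ring
    simp_rw [this]
    rw [intervalIntegral.integral_add (intervalIntegrable_const.add (h1.const_mul _))
      (h2.const_mul _), intervalIntegral.integral_add intervalIntegrable_const (h1.const_mul _),
      intervalIntegral.integral_const_mul, intervalIntegral.integral_const_mul,
      intervalIntegral.integral_const, smul_eq_mul]
    ring
  have hV : 0 ≤ S - m ^ 2 / t := by
    have h : 0 ≤ ∫ s in (0 : ℝ)..t, (-(m / t) + 1 * E s) ^ 2 :=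
      intervalIntegral.integral_nonneg ht.le fun s _ => sq_nonneg _
    rw [hquad] at h
    convert h using 1
    field_simp
    ring
  let R : Ω → ℝ := fun ω =>
    X₀ ω + c + (E t * W t ω - ∫ s in (0 : ℝ)..t, g s * W s ω) - m / t * W t ω
  have hlaw : ∀ p q : ℝ, AEMeasurable (fun ω => q * R ω + p * W t ω) ∧
      Measure.map (fun ω => q * R ω + p * W t ω) (ℙ : Measure Ω) =
        gaussianReal (q * (x₀ + c)) (‖q‖₊ ^ 2 * (σ₀ ^ 2 + S - m ^ 2 / t).toNNReal +
          ‖p‖₊ ^ 2 * t.toNNReal) := fun p q => by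
    have hX₀' : HasLaw (fun ω => q * (X₀ ω + c))
        (gaussianReal (q * (x₀ + c)) (‖q‖₊ ^ 2 * (σ₀ ^ 2).toNNReal)) ℙ := by
      convert gaussianReal_const_mul
        (gaussianReal_add_const ⟨hX₀meas.aemeasurable, hX₀law⟩ c) q using 3
      exact NNReal.eq (by simp)
    have hcomap : MeasurableSpace.comap (fun ω => q * (X₀ ω + c)) inferInstance ≤
        MeasurableSpace.comap X₀ inferInstance := by
      rw [← measurable_iff_comap_le]
      exact ((comap_measurable X₀).add_const c).const_mul q
    have h := map_add_wienerIntegral_eq_gaussianReal hW ht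
      (E := fun s => p - q * (m / t) + q * E s) (g := fun s => q * g s) (hg.const_mul q)
      (fun u hu => by rw [intervalIntegral.integral_const_mul, hEg u hu]; ring)
      ((hX₀meas.add_const c).const_mul q) hX₀'.map_eq
      (indep_of_indep_of_le_left hindep hcomap)
    have e : (fun ω => q * (X₀ ω + c) + ((p - q * (m / t) + q * E t) * W t ω -
        ∫ s in (0 : ℝ)..t, q * g s * W s ω)) = fun ω => q * R ω + p * W t ω := by
      ext ω
      simp_rw [mul_assoc q]
      rw [intervalIntegral.integral_const_mul]
      simp only [R]
      ring
    rw [e, hquad] at h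
    refine ⟨h.1, h.2.trans ?_⟩
    congr 1
    have e2 : (p - q * (m / t)) ^ 2 * t + 2 * (p - q * (m / t)) * q * m + q ^ 2 * S =
        p ^ 2 * t + q ^ 2 * (S - m ^ 2 / t) := by
      field_simp
      ring
    refine NNReal.eq ?_
    simp only [e2, NNReal.coe_add, NNReal.coe_mul, NNReal.coe_pow, coe_nnnorm, norm_eq_abs, sq_abs]
    rw [Real.coe_toNNReal _ (by positivity), Real.coe_toNNReal _ (by positivity),
      Real.coe_toNNReal _ (by linarith [sq_nonneg σ₀]), Real.coe_toNNReal _ ht.le]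
    ring
  have hR := hlaw 0 1
  simp only [one_mul, zero_mul, add_zero] at hR
  have hRlaw : Measure.map R (ℙ : Measure Ω) =
      gaussianReal (x₀ + c) (σ₀ ^ 2 + S - m ^ 2 / t).toNNReal := by
    rw [hR.2]
    congr 1
    exact NNReal.eq (by simp)
  have hWt : AEMeasurable (W t) (ℙ : Measure Ω) := (hW.1 t).aemeasurable
  have hind := indepFun_of_forall_map_eq_gaussianReal hWt hR.1 fun p q => (hlaw p q).2
  have hXR : X = fun ω => R ω + m / t * W t ω := by
    rw [hX]
    ext ω
    simp only [R]
    ring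
  filter_upwards [condDistrib_add_mul_ae_eq_gaussianReal hWt hR.1 hind hRlaw (m / t)] with w hw
  rw [hXR, hw]
  congr 1
  ring
end

section
/- Let W be a standard Brownian motion on a probability space (Ω, 𝓕, P), let t > 0, let B : [0,t] → ℝ be continuous and K : [0,t] → ℝ be continuously differentiable, and set B̄(s) := ∫ₛᵗ B(r) dr. Define Z := z + ∫₀ᵗ B̄(s)K(s) dW_s, where the Wiener integral is defined pathwise by integration by parts (since B̄(t) = 0 this equals z − ∫₀ᵗ (B̄K)′(s) W_s ds). Then, for almost every w with respect to the law of W_t, the conditional distribution of Z given W_t = w is the Gaussian distribution N( z + (w/t)·∫₀ᵗ B̄(s)K(s) ds , ∫₀ᵗ (B̄(s)K(s))² ds − (∫₀ᵗ B̄(s)K(s) ds)²/t ). -/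
open MeasureTheory ProbabilityTheory Real

open Filter Topology

/-- A weighted sum over the uniform grid of mesh `t / N`, written as an integral of a step
function. -/
lemma sum_integral_mul_eq_integral_mul_ceil {g : ℝ → ℝ} {t : ℝ} (ht : 0 < t)
    (hg : IntervalIntegrable g volume 0 t) (φ : ℝ → ℝ) {N : ℕ} (hN : 0 < N) :
    IntervalIntegrable (fun s => g s * φ (t * ⌈N * s / t⌉₊ / N)) volume 0 t ∧
    ∑ i : Fin N, (∫ s in (t * i / N)..(t * (i + 1 : ℕ) / N), g s) * φ (t * (i + 1 : ℕ) / N) =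
      ∫ s in (0:ℝ)..t, g s * φ (t * ⌈N * s / t⌉₊ / N) := by
  have hN' : (0 : ℝ) < N := by exact_mod_cast hN
  have hle (i : ℕ) : t * i / N ≤ t * (i + 1 : ℕ) / N := by
    gcongr; omega
  have hcongr (i : ℕ) : Set.EqOn (fun s => g s * φ (t * (i + 1 : ℕ) / N))
      (fun s => g s * φ (t * ⌈N * s / t⌉₊ / N)) (Set.uIoc (t * i / N) (t * (i + 1 : ℕ) / N)) := by
    intro s hs
    rw [Set.uIoc_of_le (hle i)] at hs
    have hceil : ⌈N * s / t⌉₊ = i + 1 := by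
      rw [Nat.ceil_eq_iff (by omega)]
      obtain ⟨h1, h2⟩ := hs
      rw [div_lt_iff₀ hN'] at h1
      rw [le_div_iff₀ hN'] at h2
      constructor
      · rw [lt_div_iff₀ ht]; simp only [Nat.add_sub_cancel]; linarith
      · rw [div_le_iff₀ ht]; linarith
    simp only [hceil]
  have hint (i : ℕ) (hi : i < N) :
      IntervalIntegrable (fun s => g s * φ (t * ⌈N * s / t⌉₊ / N)) volume
        (t * i / N) (t * (i + 1 : ℕ) / N) := by
    refine IntervalIntegrable.congr (hcongr i) (IntervalIntegrable.mul_const (hg.mono_set ?_) _)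
    rw [Set.uIcc_of_le (hle i), Set.uIcc_of_le ht.le]
    refine Set.Icc_subset_Icc (by positivity) ?_
    rw [div_le_iff₀ hN']
    gcongr
    exact_mod_cast hi
  have h0 : t * (0 : ℕ) / N = 0 := by simp
  have h1 : t * N / N = t := by field_simp
  constructor
  · have := IntervalIntegrable.trans_iterate (a := fun i : ℕ => t * i / N) hint
    rwa [h0, h1] at this
  · have := intervalIntegral.sum_integral_adjacent_intervals (a := fun i : ℕ => t * i / N) hint
    rw [h0, h1] at this
    rw [← this, Fin.sum_univ_eq_sum_range
      (fun i => (∫ s in (t * i / N)..(t * (i + 1 : ℕ) / N), g s) * φ (t * (i + 1 : ℕ) / N))]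
    refine Finset.sum_congr rfl fun i _ => ?_
    rw [← intervalIntegral.integral_mul_const]
    exact intervalIntegral.integral_congr_ae (.of_forall (hcongr i))

lemma le_mul_ceil_div {t : ℝ} (ht : 0 < t) {N : ℕ} (hN : 0 < N) (s : ℝ) :
    s ≤ t * ⌈N * s / t⌉₊ / N := by
  have hN' : (0 : ℝ) < N := by exact_mod_cast hN
  have := Nat.le_ceil (N * s / t)
  rw [div_le_iff₀ ht] at this
  rw [le_div_iff₀ hN']
  linarith

lemma mul_ceil_div_le {t : ℝ} (ht : 0 < t) {N : ℕ} (hN : 0 < N) {s : ℝ} (hs : s ≤ t) :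
    t * ⌈N * s / t⌉₊ / N ≤ t := by
  have hN' : (0 : ℝ) < N := by exact_mod_cast hN
  have : (⌈N * s / t⌉₊ : ℝ) ≤ N := by
    norm_cast
    rw [Nat.ceil_le, div_le_iff₀ ht]
    gcongr
  rw [div_le_iff₀ hN']
  gcongr

lemma tendsto_mul_ceil_div {t : ℝ} (ht : 0 < t) {s : ℝ} (hs : 0 ≤ s) :
    Tendsto (fun n : ℕ => t * ⌈((n + 1 : ℕ) : ℝ) * s / t⌉₊ / ((n + 1 : ℕ) : ℝ)) atTop (𝓝 s) := by
  refine tendsto_of_tendsto_of_tendsto_of_le_of_le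
    (h := fun n : ℕ => s + t * (1 / ((n : ℝ) + 1))) tendsto_const_nhds ?_
    (fun n => le_mul_ceil_div ht n.succ_pos s) (fun n => ?_)
  · simpa using tendsto_const_nhds.add
      ((tendsto_one_div_add_atTop_nhds_zero_nat (𝕜 := ℝ)).const_mul t)
  · have hn : (0 : ℝ) < ((n + 1 : ℕ) : ℝ) := by positivity
    have := Nat.ceil_lt_add_one (a := ((n + 1 : ℕ) : ℝ) * s / t) (by positivity)
    dsimp only
    rw [← Nat.cast_add_one, div_le_iff₀ hn, show (s + t * (1 / ((n + 1 : ℕ) : ℝ))) * ((n + 1 : ℕ) : ℝ) =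
      t * (((n + 1 : ℕ) : ℝ) * s / t + 1) by field_simp]
    gcongr

lemma norm_sum_integral_mul_le {g : ℝ → ℝ} {t : ℝ} (ht : 0 < t)
    (hg : IntervalIntegrable g volume 0 t) {φ : ℝ → ℝ} {M : ℝ}
    (hM : ∀ s ∈ Set.Icc 0 t, ‖φ s‖ ≤ M) {N : ℕ} (hN : 0 < N) :
    ‖∑ i : Fin N, (∫ s in (t * i / N)..(t * (i + 1 : ℕ) / N), g s) * φ (t * (i + 1 : ℕ) / N)‖ ≤
      ∫ s in (0:ℝ)..t, ‖g s‖ * M := by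
  rw [(sum_integral_mul_eq_integral_mul_ceil ht hg φ hN).2]
  refine intervalIntegral.norm_integral_le_of_norm_le ht.le (.of_forall fun s hs => ?_)
    (hg.norm.mul_const M)
  rw [norm_mul]
  gcongr
  exact hM _ ⟨hs.1.le.trans (le_mul_ceil_div ht hN s), mul_ceil_div_le ht hN hs.2⟩

lemma tendsto_sum_integral_mul {g : ℝ → ℝ} {t : ℝ} (ht : 0 < t)
    (hg : IntervalIntegrable g volume 0 t) {φ : ℝ → ℝ} {M : ℝ}
    (hM : ∀ s ∈ Set.Icc 0 t, ‖φ s‖ ≤ M) (hφ : ∀ᵐ s, s ∈ Set.Ioc 0 t → ContinuousAt φ s) :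
    Tendsto (fun n : ℕ => ∑ i : Fin (n + 1),
      (∫ s in (t * i / (n + 1 : ℕ))..(t * (i + 1 : ℕ) / (n + 1 : ℕ)), g s) *
        φ (t * (i + 1 : ℕ) / (n + 1 : ℕ))) atTop (𝓝 (∫ s in (0:ℝ)..t, g s * φ s)) := by
  simp_rw [fun n : ℕ => (sum_integral_mul_eq_integral_mul_ceil ht hg φ n.succ_pos).2]
  refine intervalIntegral.tendsto_integral_filter_of_dominated_convergence
    (fun s => ‖g s‖ * M) ?_ ?_ (hg.norm.mul_const M) ?_
  · refine .of_forall fun n => ?_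
    exact (sum_integral_mul_eq_integral_mul_ceil ht hg φ n.succ_pos).1.def'.aestronglyMeasurable
  · refine .of_forall fun n => .of_forall fun s hs => ?_
    rw [Set.uIoc_of_le ht.le] at hs
    rw [norm_mul]
    gcongr
    exact hM _ ⟨hs.1.le.trans (le_mul_ceil_div ht n.succ_pos s),
      mul_ceil_div_le ht n.succ_pos hs.2⟩
  · filter_upwards [hφ] with s h hs
    rw [Set.uIoc_of_le ht.le] at hs
    exact ((h hs).tendsto.comp (tendsto_mul_ceil_div ht hs.1.le)).const_mul _

/-- The covariance form of Brownian motion as an integral of a square. -/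
lemma sum_mul_min_eq_integral_sq {ι : Type*} [Fintype ι] {t : ℝ} (ts c : ι → ℝ)
    (hts : ∀ i, ts i ∈ Set.Icc 0 t) :
    ∑ i, ∑ j, c i * c j * min (ts i) (ts j) =
      ∫ u in (0:ℝ)..t, (∑ i, c i * (Set.Ioi u).indicator 1 (ts i)) ^ 2 := by
  have key (i j : ι) (u : ℝ) : (c i * (Set.Ioi u).indicator (1 : ℝ → ℝ) (ts i)) *
      (c j * (Set.Ioi u).indicator (1 : ℝ → ℝ) (ts j)) =
      c i * c j * (Set.Iio (min (ts i) (ts j))).indicator (fun _ => (1 : ℝ)) u := by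
    by_cases h1 : u < ts i <;> by_cases h2 : u < ts j <;> simp [Set.indicator, h1, h2]
  have hint (i j : ι) : IntervalIntegrable
      (fun u => c i * c j * (Set.Iio (min (ts i) (ts j))).indicator (fun _ => (1 : ℝ)) u)
      volume 0 t := by
    refine IntervalIntegrable.const_mul ?_ _
    rw [intervalIntegrable_iff]
    exact (intervalIntegrable_const (c := (1 : ℝ))).def'.indicator measurableSet_Iio
  simp_rw [sq, Finset.sum_mul_sum, key]
  rw [intervalIntegral.integral_finsetSum fun i _ => by
    simpa only [Finset.sum_fn] using IntervalIntegrable.sum Finset.univ fun j _ => hint i j]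
  refine Finset.sum_congr rfl fun i _ => ?_
  rw [intervalIntegral.integral_finsetSum (fun j _ => hint i j)]
  refine Finset.sum_congr rfl fun j _ => ?_
  rw [intervalIntegral.integral_const_mul]
  congr 1
  have hm0 : 0 ≤ min (ts i) (ts j) := le_min (hts i).1 (hts j).1
  have hmt : min (ts i) (ts j) ≤ t := (min_le_left _ _).trans (hts i).2
  rw [intervalIntegral.integral_of_le (hm0.trans hmt), integral_indicator measurableSet_Iio,
    Measure.restrict_restrict measurableSet_Iio]
  have : Set.Iio (min (ts i) (ts j)) ∩ Set.Ioc 0 t = Set.Ioo 0 (min (ts i) (ts j)) := by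
    ext u
    simp only [Set.mem_inter_iff, Set.mem_Iio, Set.mem_Ioc, Set.mem_Ioo]
    exact ⟨fun h => ⟨h.2.1, h.1⟩, fun h => ⟨h.2, h.1, h.2.le.trans hmt⟩⟩
  rw [this]
  simp [hm0]

section BrownianIntegral

variable {Ω : Type*} [MeasureSpace Ω] [IsProbabilityMeasure (ℙ : Measure Ω)]

/-- If `X n` is centered Gaussian and converges almost surely, and the variances converge,
the limit is centered Gaussian with the limiting variance. -/
lemma map_eq_gaussianReal_of_tendsto_s9 {X : ℕ → Ω → ℝ} {Y : Ω → ℝ} {v : ℕ → ℝ} {V : ℝ}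
    (hX : ∀ n, Measurable (X n)) (hv : ∀ n, 0 ≤ v n)
    (hlaw : ∀ n, Measure.map (X n) (ℙ : Measure Ω) = gaussianReal 0 (v n).toNNReal)
    (hlim : ∀ᵐ ω : Ω, Tendsto (fun n => X n ω) atTop (𝓝 (Y ω)))
    (hV : Tendsto v atTop (𝓝 V)) :
    Measure.map Y (ℙ : Measure Ω) = gaussianReal 0 V.toNNReal := by
  have hY : AEMeasurable Y (ℙ : Measure Ω) :=
    aemeasurable_of_tendsto_metrizable_ae atTop (fun n => (hX n).aemeasurable) hlim
  have hV0 : 0 ≤ V := ge_of_tendsto' hV hv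
  have := Measure.isProbabilityMeasure_map hY
  refine Measure.ext_of_charFun (funext fun θ => ?_)
  have h1 : Tendsto (fun n => charFun (Measure.map (X n) (ℙ : Measure Ω)) θ) atTop
      (𝓝 (charFun (Measure.map Y (ℙ : Measure Ω)) θ)) := by
    simp_rw [charFun_apply_real]
    rw [integral_map hY (by fun_prop)]
    simp_rw [fun n => integral_map (hX n).aemeasurable (μ := (ℙ : Measure Ω))
      (f := fun x : ℝ => Complex.exp (θ * x * Complex.I)) (by fun_prop)]
    refine tendsto_integral_of_dominated_convergence (fun _ => 1)
      (fun n => ?_) (integrable_const _) (fun n => .of_forall fun ω => ?_) ?_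
    · have := hX n
      fun_prop
    · rw [← Complex.ofReal_mul, Complex.norm_exp_ofReal_mul_I]
    · filter_upwards [hlim] with ω hω
      have hc : Continuous fun x : ℝ => Complex.exp (θ * x * Complex.I) := by fun_prop
      exact (hc.tendsto _).comp hω
  refine tendsto_nhds_unique h1 ?_
  simp_rw [hlaw, charFun_gaussianReal]
  have hc : Continuous fun x : ℝ => Complex.exp
      (θ * (0 : ℝ) * Complex.I - (x.toNNReal : ℝ) * θ ^ 2 / 2) := by fun_prop
  exact (hc.tendsto V).comp hV

/-- The law of a linear combination of `W t` and of a time integral of `W`. -/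
lemma IsStandardBrownianMotion.map_add_integral_eq {W : ℝ → Ω → ℝ}
    (hW : IsStandardBrownianMotion W) {t : ℝ} (ht : 0 < t) {g : ℝ → ℝ}
    (hg : IntervalIntegrable g volume 0 t) (a b : ℝ) :
    Measure.map (fun ω => a * W t ω + b * ∫ s in (0:ℝ)..t, g s * W s ω) (ℙ : Measure Ω) =
      gaussianReal 0 (∫ u in (0:ℝ)..t, (a + b * ∫ s in u..t, g s) ^ 2).toNNReal := by
  obtain ⟨hmeas, hcont, -, hlaw⟩ := hW
  set q : (n : ℕ) → Fin (n + 1) → ℝ := fun n i =>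
    ∫ s in (t * i / (n + 1 : ℕ))..(t * (i + 1 : ℕ) / (n + 1 : ℕ)), g s
  set τ : (n : ℕ) → Fin (n + 1) → ℝ := fun n i => t * (i + 1 : ℕ) / (n + 1 : ℕ) with hτ
  set ts : (n : ℕ) → Fin (n + 2) → ℝ := fun n => Fin.cons t (τ n)
  set c : (n : ℕ) → Fin (n + 2) → ℝ := fun n => Fin.cons a fun i => b * q n i
  have hsum (n : ℕ) (φ : ℝ → ℝ) :
      ∑ i, c n i * φ (ts n i) = a * φ t + b * ∑ i, q n i * φ (τ n i) := by
    rw [Fin.sum_univ_succ]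
    simp [c, ts, Finset.mul_sum, mul_assoc]
  have hts (n : ℕ) (i : Fin (n + 2)) : ts n i ∈ Set.Icc 0 t := by
    refine Fin.cases ?_ (fun i => ?_) i
    · exact ⟨ht.le, le_rfl⟩
    · simp only [ts, Fin.cons_succ, hτ]
      refine ⟨by positivity, ?_⟩
      rw [div_le_iff₀ (by positivity)]
      gcongr
      have := i.2
      omega
  refine map_eq_gaussianReal_of_tendsto_s9 (X := fun n ω => ∑ i, c n i * W (ts n i) ω)
    (v := fun n => ∑ i, ∑ j, c n i * c n j * min (ts n i) (ts n j)) ?_ ?_ ?_ ?_ ?_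
  · exact fun n => Finset.measurable_sum _ fun i _ => (hmeas _).const_mul _
  · intro n
    rw [sum_mul_min_eq_integral_sq _ _ (hts n)]
    exact intervalIntegral.integral_nonneg ht.le fun u _ => sq_nonneg _
  · exact fun n => hlaw _ _ _ fun i => (hts n i).1
  · filter_upwards [hcont] with ω hω
    simp_rw [hsum _ fun s => W s ω]
    obtain ⟨M, hM⟩ := isCompact_Icc.exists_bound_of_continuousOn (s := Set.Icc 0 t)
      hω.continuousOn
    exact ((tendsto_sum_integral_mul ht hg hM
      (.of_forall fun s _ => hω.continuousAt)).const_mul b).const_add _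
  · simp_rw [fun n => sum_mul_min_eq_integral_sq (ts n) (c n) (hts n)]
    have hone (u : ℝ) : ∀ s ∈ Set.Icc 0 t, ‖(Set.Ioi u).indicator (1 : ℝ → ℝ) s‖ ≤ 1 := by
      intro s _
      by_cases h : u < s <;> simp [Set.indicator, h]
    refine intervalIntegral.tendsto_integral_filter_of_dominated_convergence
      (fun _ => (|a| + |b| * ∫ s in (0:ℝ)..t, ‖g s‖ * 1) ^ 2) ?_ ?_ (by simp) ?_
    · refine .of_forall fun n => Measurable.aestronglyMeasurable ?_
      refine Measurable.pow_const (Finset.measurable_sum _ fun i _ => Measurable.const_mul ?_ _) _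
      have : (fun u => (Set.Ioi u).indicator (1 : ℝ → ℝ) (ts n i)) =
          (Set.Iio (ts n i)).indicator 1 := by
        ext u
        simp [Set.indicator]
      rw [this]
      exact measurable_one.indicator measurableSet_Iio
    · refine .of_forall fun n => .of_forall fun u _ => ?_
      rw [hsum, norm_pow]
      gcongr
      refine (norm_add_le _ _).trans ?_
      rw [norm_mul, norm_mul, Real.norm_eq_abs a, Real.norm_eq_abs b]
      gcongr
      · exact mul_le_of_le_one_right (abs_nonneg a) (hone u t ⟨ht.le, le_rfl⟩)
      · exact norm_sum_integral_mul_le ht hg (hone u) n.succ_pos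
    · have hne : ∀ᵐ u : ℝ, u ≠ t := by simp [ae_iff]
      filter_upwards [hne] with u hut hu
      rw [Set.uIoc_of_le ht.le] at hu
      have hult : u < t := lt_of_le_of_ne hu.2 hut
      simp_rw [hsum]
      refine Tendsto.pow (Tendsto.add ?_ (Tendsto.const_mul _ ?_)) 2
      · simp [hult]
      · have hne : ∀ᵐ s : ℝ, s ≠ u := by simp [ae_iff]
        have := tendsto_sum_integral_mul ht hg (hone u) (by
          filter_upwards [hne] with s hs _
          rcases lt_or_gt_of_ne hs with h | h
          · exact (continuousAt_const (y := (0 : ℝ))).congr (by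
              filter_upwards [Iio_mem_nhds h] with x hx
              simp [Set.indicator, (Set.mem_Iio.1 hx).le])
          · exact (continuousAt_const (y := (1 : ℝ))).congr (by
              filter_upwards [Ioi_mem_nhds h] with x hx
              simp [Set.indicator, Set.mem_Ioi.1 hx]))
        convert this using 2
        rw [intervalIntegral.integral_of_le ht.le, intervalIntegral.integral_of_le hu.2]
        have hind : (fun s => g s * (Set.Ioi u).indicator 1 s) = (Set.Ioi u).indicator g := by
          ext s
          by_cases h : u < s <;> simp [Set.indicator, h]
        rw [hind, integral_indicator measurableSet_Ioi,
          Measure.restrict_restrict measurableSet_Ioi]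
        congr 2
        ext s
        simp only [Set.mem_inter_iff, Set.mem_Ioc, Set.mem_Ioi]
        exact ⟨fun h => ⟨h.1, hu.1.trans h.1, h.2⟩, fun h => ⟨h.1, h.2.2⟩⟩

end BrownianIntegral

/-- Two real random variables whose linear combinations are all centered Gaussian with additive
variances are independent. -/
lemma indepFun_of_map_linear_eq_gaussianReal {Ω : Type*} {mΩ : MeasurableSpace Ω} {μ : Measure Ω}
    [IsProbabilityMeasure μ] {X R : Ω → ℝ} (hX : AEMeasurable X μ) (hR : AEMeasurable R μ)
    {v₁ v₂ : ℝ} (hv₁ : 0 ≤ v₁) (hv₂ : 0 ≤ v₂)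
    (h : ∀ α β : ℝ, μ.map (fun ω => α * X ω + β * R ω) =
      gaussianReal 0 (α ^ 2 * v₁ + β ^ 2 * v₂).toNNReal) :
    IndepFun X R μ := by
  rw [indepFun_iff_charFunDual_prod hX hR]
  intro L
  have hL (x y : ℝ) : L (x, y) = L (1, 0) * x + L (0, 1) * y := by
    have : ((x, y) : ℝ × ℝ) = x • ((1, 0) : ℝ × ℝ) + y • ((0, 1) : ℝ × ℝ) := by simp
    rw [this, map_add, map_smul, map_smul, smul_eq_mul, smul_eq_mul]
    ring
  rw [charFunDual_eq_charFun_map_one, charFunDual_eq_charFun_map_one,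
    charFunDual_eq_charFun_map_one,
    AEMeasurable.map_map_of_aemeasurable (by fun_prop) (by fun_prop),
    AEMeasurable.map_map_of_aemeasurable (by fun_prop) (by fun_prop),
    AEMeasurable.map_map_of_aemeasurable (by fun_prop) (by fun_prop)]
  have e1 : ⇑L ∘ (fun ω => (X ω, R ω)) = fun ω => L (1, 0) * X ω + L (0, 1) * R ω := by
    ext ω
    exact hL _ _
  have e2 : ⇑(L.comp (.inl ℝ ℝ ℝ)) ∘ X = fun ω => L (1, 0) * X ω + 0 * R ω := by
    ext ω
    simp [hL (X ω) 0]
  have e3 : ⇑(L.comp (.inr ℝ ℝ ℝ)) ∘ R = fun ω => 0 * X ω + L (0, 1) * R ω := by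
    ext ω
    simp [hL 0 (R ω)]
  rw [e1, e2, e3, h, h, h, charFun_gaussianReal, charFun_gaussianReal, charFun_gaussianReal,
    ← Complex.exp_add]
  congr 1
  rw [Real.coe_toNNReal _ (by positivity), Real.coe_toNNReal _ (by positivity),
    Real.coe_toNNReal _ (by positivity)]
  push_cast
  ring

lemma condDistrib_add_of_indepFun {Ω : Type*} {mΩ : MeasurableSpace Ω} {μ : Measure Ω}
    [IsProbabilityMeasure μ] {X R : Ω → ℝ} (hX : AEMeasurable X μ) (hR : AEMeasurable R μ)
    (hXR : IndepFun X R μ) {m : ℝ → ℝ} (hm : Measurable m) {v : NNReal}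
    (hlaw : μ.map R = gaussianReal 0 v) :
    ∀ᵐ x ∂(μ.map X), condDistrib (fun ω => m (X ω) + R ω) X μ x = gaussianReal (m x) v := by
  have hf : Measurable fun p : ℝ × ℝ => m p.1 + p.2 := by fun_prop
  let κ : Kernel ℝ ℝ :=
    (Kernel.id ×ₖ Kernel.const ℝ (gaussianReal 0 v)).map fun p => m p.1 + p.2
  have : IsMarkovKernel κ := Kernel.IsMarkovKernel.map _ hf
  have hκ (x : ℝ) : κ x = (gaussianReal 0 v).map (fun y => m x + y) := by
    rw [Kernel.map_apply _ hf, Kernel.prod_apply, Kernel.id_apply, Kernel.const_apply,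
      Measure.dirac_prod, Measure.map_map hf (by fun_prop)]
    rfl
  have key : condDistrib (fun ω => m (X ω) + R ω) X μ =ᵐ[μ.map X] κ := by
    refine condDistrib_ae_eq_of_measure_eq_compProd X
      (Y := fun ω => m (X ω) + R ω) ((hm.comp_aemeasurable hX).add hR) ?_
    have hjoint := (indepFun_iff_map_prod_eq_prod_map_map hX hR).1 hXR
    have hg : Measurable fun p : ℝ × ℝ => (p.1, m p.1 + p.2) := by fun_prop
    have : μ.map (fun ω => (X ω, m (X ω) + R ω)) =
        ((μ.map X).prod (μ.map R)).map (fun p => (p.1, m p.1 + p.2)) := by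
      rw [← hjoint, AEMeasurable.map_map_of_aemeasurable hg.aemeasurable (hX.prodMk hR)]
      rfl
    rw [this, hlaw]
    refine Measure.ext_of_lintegral _ fun f hf' => ?_
    rw [lintegral_map hf' hg, lintegral_prod _ (by fun_prop), Measure.lintegral_compProd hf']
    refine lintegral_congr fun x => ?_
    rw [hκ, lintegral_map (by fun_prop) (by fun_prop)]
  filter_upwards [key] with x hx
  rw [hx, hκ, gaussianReal_map_const_add, zero_add]

/-- Fundamental theorem of calculus for the product of `∫ r in s..t, B r` with a `C¹` function. -/
lemma integral_deriv_primitive_mul {t : ℝ} (ht : 0 < t) {B K : ℝ → ℝ}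
    (hB : ContinuousOn B (Set.Icc 0 t)) (hK : ContDiffOn ℝ 1 K (Set.Icc 0 t)) :
    ContinuousOn (fun s => (∫ r in s..t, B r) * K s) (Set.Icc 0 t) ∧
    ContinuousOn (fun s => -(B s * K s) + (∫ r in s..t, B r) * derivWithin K (Set.Icc 0 t) s)
      (Set.Icc 0 t) ∧
    ∀ u ∈ Set.Icc 0 t,
      ∫ s in u..t, (-(B s * K s) + (∫ r in s..t, B r) * derivWithin K (Set.Icc 0 t) s) =
        -((∫ r in u..t, B r) * K u) := by
  have hP : ContinuousOn (fun s => ∫ r in s..t, B r) (Set.Icc 0 t) := by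
    have := intervalIntegral.continuousOn_primitive_interval_left (a := 0) (b := t) (f := B)
      (μ := volume) (by rw [Set.uIcc_of_le ht.le]; exact hB.integrableOn_Icc)
    rwa [Set.uIcc_of_le ht.le] at this
  have hK' : ContinuousOn (derivWithin K (Set.Icc 0 t)) (Set.Icc 0 t) :=
    hK.continuousOn_derivWithin (uniqueDiffOn_Icc ht) le_rfl
  have hF : ContinuousOn (fun s => (∫ r in s..t, B r) * K s) (Set.Icc 0 t) :=
    hP.mul hK.continuousOn
  have hg : ContinuousOn
      (fun s => -(B s * K s) + (∫ r in s..t, B r) * derivWithin K (Set.Icc 0 t) s)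
      (Set.Icc 0 t) :=
    (hB.mul hK.continuousOn).neg.add (hP.mul hK')
  refine ⟨hF, hg, fun u hu => ?_⟩
  have hsub : Set.Icc u t ⊆ Set.Icc 0 t := Set.Icc_subset_Icc_left hu.1
  rw [intervalIntegral.integral_eq_sub_of_hasDerivAt_of_le
    (f := fun s => (∫ r in s..t, B r) * K s) hu.2 (hF.mono hsub) (fun x hx => ?_)
    ((hg.mono hsub).intervalIntegrable_of_Icc hu.2)]
  · simp
  · have hx' : x ∈ Set.Ioo 0 t := ⟨hu.1.trans_lt hx.1, hx.2⟩
    have hnhds : Set.Icc 0 t ∈ 𝓝 x := Icc_mem_nhds hx'.1 hx'.2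
    have hKx : HasDerivAt K (derivWithin K (Set.Icc 0 t) x) x :=
      ((hK.differentiableOn one_ne_zero x ⟨hx'.1.le, hx'.2.le⟩).hasDerivWithinAt).hasDerivAt hnhds
    have hBx : HasDerivAt (fun s => ∫ r in s..t, B r) (-B x) x := by
      refine intervalIntegral.integral_hasDerivAt_left ?_ ?_ (hB.continuousAt hnhds)
      · exact (hB.mono (Set.Icc_subset_Icc_left hx'.1.le)).intervalIntegrable_of_Icc hx'.2.le
      · exact (hB.mono Set.Ioo_subset_Icc_self).stronglyMeasurableAtFilter isOpen_Ioo x hx'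
    exact (hBx.mul hKx).congr_deriv (by ring)

theorem position_process_conditional_law_given_Wt
    {Ω : Type*} [MeasureSpace Ω] [IsProbabilityMeasure (ℙ : Measure Ω)]
    (W : ℝ → Ω → ℝ) (hW : IsStandardBrownianMotion W)
    (t : ℝ) (ht : 0 < t) (B K : ℝ → ℝ)
    (hB : ContinuousOn B (Set.Icc 0 t))
    (hK : ContDiffOn ℝ 1 K (Set.Icc 0 t))
    (z : ℝ) (Z : Ω → ℝ)
    (hZ : Z = fun ω => z - ∫ s in (0:ℝ)..t,
      (-(B s * K s) + (∫ r in s..t, B r) * derivWithin K (Set.Icc 0 t) s) * W s ω) :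
    ∀ᵐ w ∂(Measure.map (W t) (ℙ : Measure Ω)),
      condDistrib Z (W t) (ℙ : Measure Ω) w =
        gaussianReal (z + (w / t) * ∫ s in (0:ℝ)..t, (∫ r in s..t, B r) * K s)
          (((∫ s in (0:ℝ)..t, ((∫ r in s..t, B r) * K s) ^ 2) -
            (∫ s in (0:ℝ)..t, (∫ r in s..t, B r) * K s) ^ 2 / t).toNNReal) := by
  obtain ⟨hF, hg, hint⟩ := integral_deriv_primitive_mul ht hB hK
  set F : ℝ → ℝ := fun s => (∫ r in s..t, B r) * K s
  set g : ℝ → ℝ := fun s =>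
    -(B s * K s) + (∫ r in s..t, B r) * derivWithin K (Set.Icc 0 t) s
  set I : ℝ := ∫ s in (0:ℝ)..t, F s
  set J : ℝ := ∫ s in (0:ℝ)..t, F s ^ 2
  have hFi : IntervalIntegrable F volume 0 t := hF.intervalIntegrable_of_Icc ht.le
  have hF2i : IntervalIntegrable (fun s => F s ^ 2) volume 0 t :=
    (hF.pow 2).intervalIntegrable_of_Icc ht.le
  have hgi : IntervalIntegrable g volume 0 t := hg.intervalIntegrable_of_Icc ht.le
  have hquad (a b : ℝ) : ∫ u in (0:ℝ)..t, (a + b * F u) ^ 2 =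
      a ^ 2 * t + 2 * a * b * I + b ^ 2 * J := by
    have : (fun u => (a + b * F u) ^ 2) =
        fun u => a ^ 2 + 2 * a * b * F u + b ^ 2 * F u ^ 2 := by
      ext u
      ring
    rw [this, intervalIntegral.integral_add
        (intervalIntegrable_const.add (hFi.const_mul _)) (hF2i.const_mul _),
      intervalIntegral.integral_add intervalIntegrable_const (hFi.const_mul _),
      intervalIntegral.integral_const_mul, intervalIntegral.integral_const_mul]
    simp [I, J, mul_comm]
  have hlaw (a b : ℝ) :
      Measure.map (fun ω => a * W t ω + b * ∫ s in (0:ℝ)..t, g s * W s ω) (ℙ : Measure Ω) =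
        gaussianReal 0 (a ^ 2 * t - 2 * a * b * I + b ^ 2 * J).toNNReal := by
    rw [hW.map_add_integral_eq ht hgi, show a ^ 2 * t - 2 * a * b * I + b ^ 2 * J =
      a ^ 2 * t + 2 * a * (-b) * I + (-b) ^ 2 * J by ring, ← hquad]
    congr 2
    refine intervalIntegral.integral_congr fun u hu => ?_
    rw [Set.uIcc_of_le ht.le] at hu
    simp only [hint u hu]
    ring
  have hJ : 0 ≤ J - I ^ 2 / t := by
    have h := hquad (-(I / t)) 1
    have h0 : 0 ≤ ∫ u in (0:ℝ)..t, (-(I / t) + 1 * F u) ^ 2 :=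
      intervalIntegral.integral_nonneg ht.le fun u _ => sq_nonneg _
    rw [h] at h0
    convert h0 using 1
    field_simp
    ring
  set R : Ω → ℝ := fun ω => -(I / t) * W t ω + (-1) * ∫ s in (0:ℝ)..t, g s * W s ω with hR
  have hlin (α β : ℝ) : Measure.map (fun ω => α * W t ω + β * R ω) (ℙ : Measure Ω) =
      gaussianReal 0 (α ^ 2 * t + β ^ 2 * (J - I ^ 2 / t)).toNNReal := by
    have h := hlaw (α - β * (I / t)) (-β)
    convert h using 2
    · ext ω
      simp only [hR]
      ring
    · congr 1
      field_simp
      ring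
  have hRlaw : Measure.map R (ℙ : Measure Ω) = gaussianReal 0 (J - I ^ 2 / t).toNNReal := by
    simpa using hlin 0 1
  have hRm : AEMeasurable R (ℙ : Measure Ω) := by
    refine AEMeasurable.of_map_ne_zero ?_
    rw [hRlaw]
    exact IsProbabilityMeasure.ne_zero _
  have hXm : AEMeasurable (W t) (ℙ : Measure Ω) := (hW.1 t).aemeasurable
  have hind := indepFun_of_map_linear_eq_gaussianReal hXm hRm ht.le hJ hlin
  have hZ' : Z = fun ω => (z + W t ω / t * I) + R ω := by
    rw [hZ]
    ext ω
    simp only [hR]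
    ring
  rw [hZ']
  exact condDistrib_add_of_indepFun (m := fun w => z + w / t * I) hXm hRm hind (by fun_prop)
    hRlaw
end

section
/- Let W be a standard Brownian motion on a probability space (Ω, 𝓕, P), let t > 0, let B : [0,t] → ℝ be continuous and K : [0,t] → ℝ be continuously differentiable. Define Ż := B(t)·∫₀ᵗ K(r) dW_r = B(t)·(K(t)W_t − ∫₀ᵗ K′(s)W_s ds). Then, for almost every w with respect to the law of W_t, the conditional distribution of Ż given W_t = w is the Gaussian distribution N( (w·B(t)/t)·∫₀ᵗ K(s) ds , B(t)²·[ ∫₀ᵗ K(s)² ds − (∫₀ᵗ K(s) ds)²/t ] ). -/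
open MeasureTheory ProbabilityTheory Real

open Set Filter Topology Finset

/-- The `i`-th point of the uniform partition of `[0, t]` into `n + 1` intervals. -/
noncomputable def uniformPartition (t : ℝ) (n i : ℕ) : ℝ := t * i / (n + 1)

section UniformPartition

variable {t : ℝ} {n i : ℕ}

lemma uniformPartition_zero : uniformPartition t n 0 = 0 := by simp [uniformPartition]

lemma uniformPartition_last : uniformPartition t n (n + 1) = t := by
  simp only [uniformPartition]; push_cast; field_simp

lemma uniformPartition_succ_sub :
    uniformPartition t n (i + 1) - uniformPartition t n i = t / (n + 1) := by
  simp only [uniformPartition]; push_cast; ring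

lemma uniformPartition_mono (ht : 0 ≤ t) : Monotone (uniformPartition t n) := by
  intro i j hij
  unfold uniformPartition
  gcongr

lemma uniformPartition_nonneg (ht : 0 ≤ t) : 0 ≤ uniformPartition t n i := by
  unfold uniformPartition; positivity

lemma Icc_uniformPartition_subset (ht : 0 ≤ t) (hi : i < n + 1) :
    Icc (uniformPartition t n i) (uniformPartition t n (i + 1)) ⊆ Icc 0 t := by
  refine Icc_subset_Icc (uniformPartition_nonneg ht) ?_
  exact (uniformPartition_mono ht hi).trans_eq uniformPartition_last

/-- Riemann sums of `g` against the measure `h ds`. -/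
lemma tendsto_sum_mul_intervalIntegral (ht : 0 ≤ t) {g h : ℝ → ℝ}
    (hg : ContinuousOn g (Icc 0 t)) (hh : ContinuousOn h (Icc 0 t)) {ξ : ℕ → ℕ → ℝ}
    (hξ : ∀ n i, ξ n i ∈ Icc (uniformPartition t n i) (uniformPartition t n (i + 1))) :
    Tendsto (fun n ↦ ∑ i ∈ range (n + 1), g (ξ n i) *
      ∫ s in uniformPartition t n i..uniformPartition t n (i + 1), h s) atTop
      (𝓝 (∫ s in (0 : ℝ)..t, g s * h s)) := by
  obtain ⟨M, hM⟩ := isCompact_Icc.exists_bound_of_continuousOn hh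
  have hM0 : 0 ≤ M := (norm_nonneg _).trans (hM 0 ⟨le_rfl, ht⟩)
  have huc := Metric.uniformContinuousOn_iff_le.1
    (isCompact_Icc.uniformContinuousOn_of_continuous hg)
  rw [Metric.tendsto_atTop]
  intro ε hε
  obtain ⟨δ, hδ, hgδ⟩ := huc (ε / (M * t + 1)) (by positivity)
  have hlim : Tendsto (fun n : ℕ ↦ t / ((n : ℝ) + 1)) atTop (𝓝 0) := by
    simpa [div_eq_mul_inv] using tendsto_one_div_add_atTop_nhds_zero_nat.const_mul t
  obtain ⟨N, hN⟩ := eventually_atTop.1 (hlim.eventually (gt_mem_nhds hδ))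
  refine ⟨N, fun n hn ↦ ?_⟩
  have hle : ∀ i, uniformPartition t n i ≤ uniformPartition t n (i + 1) :=
    fun i ↦ uniformPartition_mono ht i.le_succ
  have hint {k : ℝ → ℝ} (hk : ContinuousOn k (Icc 0 t)) (i : ℕ) (hi : i < n + 1) :
      IntervalIntegrable k volume (uniformPartition t n i) (uniformPartition t n (i + 1)) :=
    (hk.mono (Icc_uniformPartition_subset ht hi)).intervalIntegrable_of_Icc (hle i)
  have hgh : ContinuousOn (fun s ↦ g s * h s) (Icc 0 t) := hg.mul hh
  have hsplit := intervalIntegral.sum_integral_adjacent_intervals (hint hgh)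
  rw [uniformPartition_zero, uniformPartition_last] at hsplit
  rw [Real.dist_eq, ← hsplit, ← sum_sub_distrib]
  calc _ ≤ ∑ i ∈ range (n + 1), ε / (M * t + 1) * M * (t / (n + 1)) := by
        refine (abs_sum_le_sum_abs _ _).trans (sum_le_sum fun i hi ↦ ?_)
        have hi := Finset.mem_range.1 hi
        have hsub := Icc_uniformPartition_subset (n := n) ht hi
        rw [← intervalIntegral.integral_const_mul, ← intervalIntegral.integral_sub
          ((hint hh i hi).const_mul _) (hint hgh i hi), ← Real.norm_eq_abs]
        refine (intervalIntegral.norm_integral_le_of_norm_le_const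
          (C := ε / (M * t + 1) * M) fun s hs ↦ ?_).trans_eq ?_
        · rw [uIoc_of_le (hle i)] at hs
          have hs' := Ioc_subset_Icc_self hs
          rw [← sub_mul, norm_mul]
          gcongr
          · rw [← dist_eq_norm]
            refine hgδ _ (hsub (hξ n i)) _ (hsub hs') ?_
            refine (Real.dist_le_of_mem_Icc (hξ n i) hs').trans ?_
            rw [uniformPartition_succ_sub]
            exact (hN n hn).le
          · exact hM _ (hsub hs')
        · rw [uniformPartition_succ_sub, abs_of_nonneg (by positivity)]
    _ = ε * (M * t) / (M * t + 1) := by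
        rw [sum_const, card_range, nsmul_eq_mul]; push_cast; field_simp
    _ < ε := by
        rw [div_lt_iff₀ (by positivity)]; linarith

end UniformPartition

lemma sum_range_mul_sub (a w : ℕ → ℝ) (n : ℕ) :
    ∑ i ∈ range n, a i * (w (i + 1) - w i) =
      a n * w n - a 0 * w 0 - ∑ i ∈ range n, w (i + 1) * (a (i + 1) - a i) := by
  induction n with
  | zero => simp
  | succ n ih => rw [sum_range_succ, sum_range_succ, ih]; ring

lemma intervalIntegral_derivWithin_Icc {t a b : ℝ} (ht : 0 < t) {f : ℝ → ℝ}
    (hf : ContDiffOn ℝ 1 f (Icc 0 t)) (hab : a ≤ b) (hsub : Icc a b ⊆ Icc 0 t) :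
    ∫ s in a..b, derivWithin f (Icc 0 t) s = f b - f a := by
  have hd := hf.continuousOn_derivWithin (uniqueDiffOn_Icc ht) le_rfl
  refine intervalIntegral.integral_eq_sub_of_hasDerivAt_of_le hab (hf.continuousOn.mono hsub)
    (fun x hx ↦ ?_) ((hd.mono hsub).intervalIntegrable_of_Icc hab)
  have h0 := hsub (left_mem_Icc.2 hab)
  have h1 := hsub (right_mem_Icc.2 hab)
  have hx' : Icc 0 t ∈ 𝓝 x := Icc_mem_nhds (h0.1.trans_lt hx.1) (hx.2.trans_le h1.2)
  exact ((hf.differentiableOn one_ne_zero x (mem_of_mem_nhds hx')).hasDerivWithinAt).hasDerivAt hx'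

/-- The pathwise Wiener integral of `f` over `[0, t]` along the path `w`. -/
noncomputable def pathwiseWienerIntegral (t : ℝ) (f w : ℝ → ℝ) : ℝ :=
  f t * w t - ∫ s in (0 : ℝ)..t, derivWithin f (Icc 0 t) s * w s

lemma tendsto_sum_pathwiseWienerIntegral {t : ℝ} (ht : 0 < t) {f w : ℝ → ℝ}
    (hf : ContDiffOn ℝ 1 f (Icc 0 t)) (hw : Continuous w) (hw0 : w 0 = 0) :
    Tendsto (fun n ↦ ∑ i ∈ range (n + 1), f (uniformPartition t n i) *
      (w (uniformPartition t n (i + 1)) - w (uniformPartition t n i))) atTop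
      (𝓝 (pathwiseWienerIntegral t f w)) := by
  have hd := hf.continuousOn_derivWithin (uniqueDiffOn_Icc ht) le_rfl
  have hlim := (tendsto_sum_mul_intervalIntegral ht.le hw.continuousOn hd
    (ξ := fun n i ↦ uniformPartition t n (i + 1))
    fun n i ↦ ⟨uniformPartition_mono ht.le i.le_succ, le_rfl⟩).const_sub (f t * w t)
  simp_rw [mul_comm (w _)] at hlim
  refine hlim.congr fun n ↦ ?_
  rw [sum_range_mul_sub (fun i ↦ f (uniformPartition t n i)) fun i ↦ w (uniformPartition t n i)]
  simp only [uniformPartition_zero, uniformPartition_last, hw0, mul_zero, sub_zero]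
  congr 1
  refine sum_congr rfl fun i hi ↦ ?_
  rw [intervalIntegral_derivWithin_Icc ht hf (uniformPartition_mono ht.le i.le_succ)
    (Icc_uniformPartition_subset ht.le (Finset.mem_range.1 hi)), mul_comm]

lemma pathwiseWienerIntegral_const_add_mul {t : ℝ} (ht : 0 < t) {f w : ℝ → ℝ}
    (hf : ContDiffOn ℝ 1 f (Icc 0 t)) (x y : ℝ) :
    pathwiseWienerIntegral t (fun s ↦ x + y * f s) w =
      x * w t + y * pathwiseWienerIntegral t f w := by
  have h : ∫ s in (0 : ℝ)..t, derivWithin (fun s ↦ x + y * f s) (Icc 0 t) s * w s =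
      y * ∫ s in (0 : ℝ)..t, derivWithin f (Icc 0 t) s * w s := by
    rw [← intervalIntegral.integral_const_mul]
    refine intervalIntegral.integral_congr fun s hs ↦ ?_
    rw [uIcc_of_le ht.le] at hs
    rw [derivWithin_const_add_fun, derivWithin_const_mul _ (hf.differentiableOn one_ne_zero s hs)]
    ring
  rw [pathwiseWienerIntegral, pathwiseWienerIntegral, h]
  ring

lemma intervalIntegral_const_add_mul_sq {t : ℝ} {f : ℝ → ℝ}
    (hf : IntervalIntegrable f volume 0 t)
    (hf2 : IntervalIntegrable (fun s ↦ f s ^ 2) volume 0 t) (x y : ℝ) :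
    ∫ s in (0 : ℝ)..t, (x + y * f s) ^ 2 =
      x ^ 2 * t + 2 * x * y * (∫ s in (0 : ℝ)..t, f s) +
        y ^ 2 * ∫ s in (0 : ℝ)..t, f s ^ 2 := by
  have he : ∀ s, (x + y * f s) ^ 2 = x ^ 2 + 2 * x * y * f s + y ^ 2 * f s ^ 2 :=
    fun s ↦ by ring
  simp_rw [he]
  rw [intervalIntegral.integral_add (intervalIntegrable_const.add (hf.const_mul _))
      (hf2.const_mul _),
    intervalIntegral.integral_add intervalIntegrable_const (hf.const_mul _),
    intervalIntegral.integral_const_mul, intervalIntegral.integral_const_mul,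
    intervalIntegral.integral_const, smul_eq_mul, sub_zero, mul_comm t]

section BrownianMotion

variable {Ω : Type*} [MeasureSpace Ω] {W : ℝ → Ω → ℝ}

/-- Elementary integrals of step functions against a Brownian motion are Gaussian. -/
lemma IsStandardBrownianMotion.map_sum_mul_sub (hW : IsStandardBrownianMotion W) {τ : ℕ → ℝ}
    (hτ : Monotone τ) (hτ0 : ∀ i, 0 ≤ τ i) (a : ℕ → ℝ) (n : ℕ) :
    Measure.map (fun ω ↦ ∑ i ∈ range n, a i * (W (τ (i + 1)) ω - W (τ i) ω)) (ℙ : Measure Ω) =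
      gaussianReal 0 (∑ i ∈ range n, a i ^ 2 * (τ (i + 1) - τ i)).toNNReal := by
  have h := hW.2.2.2 (n + n) (Fin.append (fun i ↦ τ (i + 1)) fun i ↦ τ i)
    (Fin.append (fun i ↦ a i) fun i ↦ -a i) (fun i ↦ by
      induction i using Fin.addCases <;>
        simp only [Fin.append_left, Fin.append_right, hτ0])
  convert h using 3
  · simp only [Fin.sum_univ_add, Fin.append_left, Fin.append_right, sum_range]
    rw [← sum_add_distrib]
    exact sum_congr rfl fun i _ ↦ by ring
  · simp only [Fin.sum_univ_add, Fin.append_left, Fin.append_right, sum_range]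
    rw [← sum_add_distrib]
    refine sum_congr rfl fun i _ ↦ ?_
    simp only [← sum_add_distrib]
    rw [Fintype.sum_eq_single i]
    · rw [min_self, min_self, min_eq_left (hτ i.1.le_succ), min_eq_right (hτ i.1.le_succ)]
      ring
    · intro j hj
      rcases lt_or_gt_of_ne hj with hji | hij
      · have h1 : τ (j + 1) ≤ τ i := hτ hji
        have h2 := hτ j.1.le_succ
        have h3 := hτ i.1.le_succ
        rw [min_eq_right (h1.trans h3), min_eq_right (h2.trans (h1.trans h3)), min_eq_right h1,
          min_eq_right (h2.trans h1)]
        ring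
      · have h1 : τ (i + 1) ≤ τ j := hτ hij
        have h2 := hτ j.1.le_succ
        have h3 := hτ i.1.le_succ
        rw [min_eq_left (h1.trans h2), min_eq_left h1, min_eq_left (h3.trans (h1.trans h2)),
          min_eq_left (h3.trans h1)]
        ring

lemma IsStandardBrownianMotion.ae_tendsto_pathwiseWienerIntegral
    (hW : IsStandardBrownianMotion W) {t : ℝ} (ht : 0 < t) {f : ℝ → ℝ}
    (hf : ContDiffOn ℝ 1 f (Icc 0 t)) :
    ∀ᵐ ω : Ω, Tendsto (fun n ↦ ∑ i ∈ range (n + 1), f (uniformPartition t n i) *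
      (W (uniformPartition t n (i + 1)) ω - W (uniformPartition t n i) ω)) atTop
      (𝓝 (pathwiseWienerIntegral t f (W · ω))) := by
  filter_upwards [hW.2.1, hW.2.2.1] with ω hc h0
  exact tendsto_sum_pathwiseWienerIntegral ht hf hc h0

lemma IsStandardBrownianMotion.aemeasurable_sum_mul_sub
    (hW : IsStandardBrownianMotion W) (τ a : ℕ → ℝ) (n : ℕ) :
    AEMeasurable (fun ω ↦ ∑ i ∈ range n, a i * (W (τ (i + 1)) ω - W (τ i) ω))
      (ℙ : Measure Ω) := by
  have := hW.1
  fun_prop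

lemma IsStandardBrownianMotion.aemeasurable_pathwiseWienerIntegral
    (hW : IsStandardBrownianMotion W) {t : ℝ} (ht : 0 < t) {f : ℝ → ℝ}
    (hf : ContDiffOn ℝ 1 f (Icc 0 t)) :
    AEMeasurable (fun ω ↦ pathwiseWienerIntegral t f (W · ω)) (ℙ : Measure Ω) :=
  aemeasurable_of_tendsto_metrizable_ae atTop
    (fun n ↦ hW.aemeasurable_sum_mul_sub (uniformPartition t n)
      (fun i ↦ f (uniformPartition t n i)) (n + 1))
    (hW.ae_tendsto_pathwiseWienerIntegral ht hf)

variable [IsProbabilityMeasure (ℙ : Measure Ω)]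

/-- Almost sure limits of centered Gaussian variables with converging variances are Gaussian. -/
lemma map_eq_gaussianReal_of_ae_tendsto {X : ℕ → Ω → ℝ} {Y : Ω → ℝ} {v : ℕ → NNReal}
    {v' : NNReal} (hX : ∀ n, AEMeasurable (X n) (ℙ : Measure Ω))
    (hlaw : ∀ n, Measure.map (X n) (ℙ : Measure Ω) = gaussianReal 0 (v n))
    (hv : Tendsto v atTop (𝓝 v'))
    (hXY : ∀ᵐ ω : Ω, Tendsto (fun n ↦ X n ω) atTop (𝓝 (Y ω))) :
    Measure.map Y (ℙ : Measure Ω) = gaussianReal 0 v' := by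
  have hY := aemeasurable_of_tendsto_metrizable_ae atTop hX hXY
  have := Measure.isProbabilityMeasure_map hY
  refine Measure.ext_of_charFun (funext fun u ↦ ?_)
  have hchar {Z : Ω → ℝ} (hZ : AEMeasurable Z (ℙ : Measure Ω)) :
      charFun (Measure.map Z (ℙ : Measure Ω)) u = ∫ ω, Complex.exp (u * Z ω * Complex.I) := by
    rw [charFun_apply_real, integral_map hZ (by fun_prop)]
  have h1 : Tendsto (fun n ↦ charFun (Measure.map (X n) (ℙ : Measure Ω)) u) atTop
      (𝓝 (charFun (Measure.map Y (ℙ : Measure Ω)) u)) := by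
    simp_rw [hchar (hX _), hchar hY]
    refine tendsto_integral_of_dominated_convergence (fun _ ↦ 1) (fun n ↦ ?_)
      (integrable_const _) (fun n ↦ ?_) ?_
    · have := hX n
      exact AEMeasurable.aestronglyMeasurable (by fun_prop)
    · refine .of_forall fun ω ↦ le_of_eq ?_
      exact_mod_cast Complex.norm_exp_ofReal_mul_I (u * X n ω)
    · filter_upwards [hXY] with ω hω
      have hc : Continuous fun x : ℝ ↦ Complex.exp (u * x * Complex.I) := by fun_prop
      exact (hc.tendsto _).comp hω
  have h2 : Tendsto (fun n ↦ charFun (Measure.map (X n) (ℙ : Measure Ω)) u) atTop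
      (𝓝 (charFun (gaussianReal 0 v') u)) := by
    simp_rw [hlaw, charFun_gaussianReal]
    have hc : Continuous fun x : NNReal ↦
        Complex.exp (u * (0 : ℝ) * Complex.I - (x : ℝ) * u ^ 2 / 2) := by fun_prop
    exact (hc.tendsto _).comp hv
  exact tendsto_nhds_unique h1 h2

/-- The Wiener integral of a continuously differentiable function is centered Gaussian, with
variance given by the Itô isometry. -/
lemma IsStandardBrownianMotion.map_pathwiseWienerIntegral
    (hW : IsStandardBrownianMotion W) {t : ℝ} (ht : 0 < t) {f : ℝ → ℝ}
    (hf : ContDiffOn ℝ 1 f (Icc 0 t)) :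
    Measure.map (fun ω ↦ pathwiseWienerIntegral t f (W · ω)) (ℙ : Measure Ω) =
      gaussianReal 0 (∫ s in (0 : ℝ)..t, f s ^ 2).toNNReal := by
  have hvar := tendsto_sum_mul_intervalIntegral ht.le (hf.continuousOn.pow 2)
    (continuousOn_const (c := (1 : ℝ))) (ξ := uniformPartition t)
    fun n i ↦ ⟨le_rfl, uniformPartition_mono ht.le i.le_succ⟩
  simp only [intervalIntegral.integral_const, smul_eq_mul, mul_one] at hvar
  exact map_eq_gaussianReal_of_ae_tendsto
    (fun n ↦ hW.aemeasurable_sum_mul_sub (uniformPartition t n)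
      (fun i ↦ f (uniformPartition t n i)) (n + 1))
    (fun n ↦ hW.map_sum_mul_sub (uniformPartition_mono ht.le)
      (fun _ ↦ uniformPartition_nonneg ht.le) _ _)
    ((continuous_real_toNNReal.tendsto _).comp hvar)
    (hW.ae_tendsto_pathwiseWienerIntegral ht hf)

/-- A Wiener integral whose integrand has mean zero is independent of the terminal value. -/
lemma IsStandardBrownianMotion.indepFun_pathwiseWienerIntegral
    (hW : IsStandardBrownianMotion W) {t : ℝ} (ht : 0 < t) {f : ℝ → ℝ}
    (hf : ContDiffOn ℝ 1 f (Icc 0 t)) (hf0 : ∫ s in (0 : ℝ)..t, f s = 0) :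
    IndepFun (W t) (fun ω ↦ pathwiseWienerIntegral t f (W · ω)) (ℙ : Measure Ω) := by
  have hfi : IntervalIntegrable f volume 0 t := hf.continuousOn.intervalIntegrable_of_Icc ht.le
  have hfi2 : IntervalIntegrable (fun s ↦ f s ^ 2) volume 0 t :=
    (hf.continuousOn.pow 2).intervalIntegrable_of_Icc ht.le
  have hlaw (x y : ℝ) : Measure.map
      (fun ω ↦ x * W t ω + y * pathwiseWienerIntegral t f (W · ω)) (ℙ : Measure Ω) =
      gaussianReal 0 (x ^ 2 * t + y ^ 2 * ∫ s in (0 : ℝ)..t, f s ^ 2).toNNReal := by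
    have h := hW.map_pathwiseWienerIntegral ht
      (f := fun s ↦ x + y * f s) (contDiffOn_const.add (contDiffOn_const.mul hf))
    simp_rw [pathwiseWienerIntegral_const_add_mul ht hf] at h
    rw [h, intervalIntegral_const_add_mul_sq hfi hfi2, hf0, mul_zero, add_zero]
  have hm := hW.aemeasurable_pathwiseWienerIntegral ht hf
  have hmt : Measurable (W t) := hW.1 t
  have hWt := hlaw 1 0
  simp only [one_mul, zero_mul, add_zero, one_pow, ne_eq, OfNat.ofNat_ne_zero, not_false_eq_true,
    zero_pow] at hWt
  rw [indepFun_iff_charFun_prod hmt.aemeasurable hm]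
  intro u
  have hv : 0 ≤ ∫ s in (0 : ℝ)..t, f s ^ 2 :=
    intervalIntegral.integral_nonneg ht.le fun _ _ ↦ sq_nonneg _
  have hjoint : charFun (Measure.map (fun ω ↦ WithLp.toLp 2
      (W t ω, pathwiseWienerIntegral t f (W · ω))) (ℙ : Measure Ω)) u =
      charFun (Measure.map (fun ω ↦ u.fst * W t ω + u.snd * pathwiseWienerIntegral t f (W · ω))
        (ℙ : Measure Ω)) 1 := by
    rw [charFun_apply, charFun_apply, integral_map (by fun_prop) (by fun_prop),
      integral_map (by fun_prop) (by fun_prop)]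
    simp [WithLp.prod_inner_apply]
  have hw := hW.map_pathwiseWienerIntegral ht hf
  rw [hjoint, hlaw, hWt, hw, charFun_gaussianReal, charFun_gaussianReal, charFun_gaussianReal,
    ← Complex.exp_add, Real.coe_toNNReal _ (by positivity), Real.coe_toNNReal _ ht.le,
    Real.coe_toNNReal _ hv]
  congr 1
  push_cast
  simp only [WithLp.fst, WithLp.snd]
  ring

end BrownianMotion

/-- If `X` and `R` are independent, then the conditional law of `a X + R` given `X = x` is the law
of `a x + R`. -/
lemma condDistrib_mul_add_of_indepFun {Ω : Type*} {mΩ : MeasurableSpace Ω} {P : Measure Ω}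
    [IsProbabilityMeasure P] {X R : Ω → ℝ} (hX : AEMeasurable X P) (hR : AEMeasurable R P)
    (hXR : IndepFun X R P) (a : ℝ) :
    ∀ᵐ x ∂(P.map X), condDistrib (fun ω ↦ a * X ω + R ω) X P x =
      (P.map R).map (fun r ↦ a * x + r) := by
  have := Measure.isProbabilityMeasure_map hR
  have := Measure.isProbabilityMeasure_map hX
  let φ : ℝ × ℝ → ℝ := fun p ↦ a * p.1 + p.2
  have hφ : Measurable φ := by fun_prop
  let κ : Kernel ℝ ℝ := (Kernel.id ×ₖ Kernel.const ℝ (P.map R)).map φ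
  have hκ (x : ℝ) : κ x = (P.map R).map (fun r ↦ a * x + r) := by
    rw [Kernel.map_apply _ hφ, Kernel.prod_apply, Kernel.id_apply, Kernel.const_apply,
      Measure.dirac_prod, Measure.map_map hφ (by fun_prop)]
    rfl
  have : IsMarkovKernel κ := Kernel.IsMarkovKernel.map _ hφ
  have hjoint : P.map (fun ω ↦ (X ω, a * X ω + R ω)) = P.map X ⊗ₘ κ := by
    have h := (indepFun_iff_map_prod_eq_prod_map_map hX hR).1 hXR
    have hψ : Measurable fun p : ℝ × ℝ ↦ (p.1, a * p.1 + p.2) := by fun_prop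
    have hcomp : P.map (fun ω ↦ (X ω, a * X ω + R ω)) =
        ((P.map X).prod (P.map R)).map fun p ↦ (p.1, a * p.1 + p.2) := by
      rw [← h, AEMeasurable.map_map_of_aemeasurable hψ.aemeasurable (hX.prodMk hR)]
      rfl
    rw [hcomp]
    ext s hs
    rw [Measure.map_apply hψ hs, Measure.prod_apply (hψ hs), Measure.compProd_apply hs]
    refine lintegral_congr fun x ↦ ?_
    rw [hκ, Measure.map_apply (by fun_prop) (measurable_prodMk_left hs)]
    rfl
  filter_upwards [condDistrib_ae_eq_of_measure_eq_compProd X (by fun_prop) hjoint] with x hx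
  rw [hx, hκ]

theorem velocity_process_conditional_law_given_Wt
    {Ω : Type*} [MeasureSpace Ω] [IsProbabilityMeasure (ℙ : Measure Ω)]
    (W : ℝ → Ω → ℝ) (hW : IsStandardBrownianMotion W)
    (t : ℝ) (ht : 0 < t) (B K : ℝ → ℝ)
    (hB : ContinuousOn B (Set.Icc 0 t))
    (hK : ContDiffOn ℝ 1 K (Set.Icc 0 t))
    (Zdot : Ω → ℝ)
    (hZdot : Zdot = fun ω =>
      B t * (K t * W t ω - ∫ s in (0:ℝ)..t, derivWithin K (Set.Icc 0 t) s * W s ω)) :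
    ∀ᵐ w ∂(Measure.map (W t) (ℙ : Measure Ω)),
      condDistrib Zdot (W t) (ℙ : Measure Ω) w =
        gaussianReal ((w * B t / t) * ∫ s in (0:ℝ)..t, K s)
          ((B t ^ 2 * ((∫ s in (0:ℝ)..t, (K s) ^ 2) -
            (∫ s in (0:ℝ)..t, K s) ^ 2 / t)).toNNReal) := by
  have hKi : IntervalIntegrable K volume 0 t := hK.continuousOn.intervalIntegrable_of_Icc ht.le
  have hKi2 : IntervalIntegrable (fun s ↦ K s ^ 2) volume 0 t :=
    (hK.continuousOn.pow 2).intervalIntegrable_of_Icc ht.le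
  set I := ∫ s in (0 : ℝ)..t, K s with hI
  set a := B t / t * I with ha
  let f : ℝ → ℝ := fun s ↦ -a + B t * K s
  have hf : ContDiffOn ℝ 1 f (Set.Icc 0 t) := contDiffOn_const.add (contDiffOn_const.mul hK)
  have hf0 : ∫ s in (0 : ℝ)..t, f s = 0 := by
    rw [intervalIntegral.integral_add intervalIntegrable_const (hKi.const_mul _),
      intervalIntegral.integral_const_mul, intervalIntegral.integral_const, ← hI, ha,
      smul_eq_mul]
    field_simp
    ring
  have hf2 : ∫ s in (0 : ℝ)..t, f s ^ 2 =
      B t ^ 2 * ((∫ s in (0:ℝ)..t, K s ^ 2) - I ^ 2 / t) := by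
    rw [intervalIntegral_const_add_mul_sq hKi hKi2, ← hI, ha]
    field_simp
    ring
  have hZ : Zdot = fun ω ↦ a * W t ω + pathwiseWienerIntegral t f (W · ω) := by
    rw [hZdot]
    ext ω
    rw [pathwiseWienerIntegral_const_add_mul ht hK, pathwiseWienerIntegral]
    ring
  rw [hZ]
  filter_upwards [condDistrib_mul_add_of_indepFun (hW.1 t).aemeasurable
    (hW.aemeasurable_pathwiseWienerIntegral ht hf)
    (hW.indepFun_pathwiseWienerIntegral ht hf hf0) a] with w hw
  rw [hw, hW.map_pathwiseWienerIntegral ht hf, gaussianReal_map_const_add, hf2, ha]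
  congr 1
  ring
end
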